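/- arXiv:2111.12343 — 2 statements merged into one kernel-verified Lean document; each statement's English description precedes it below -/
import Mathlib

section
/- Let k ≥ 2 and let G be the following 2k-regular graph on 6k vertices. Take the disjoint union of: the k-regular circulant graph H on vertex set {0,…,3k-2} where i is adjacent to k+i,…,2k+i-1 (mod 3k-1); a clique A on vertices a_0,…,a_k; a coclique B on vertices b_0,…,b_k; and a coclique C on vertices c_1,…,c_{k-1}. Add edges: (i) a_i ~ b_j for all 0 ≤ i, j ≤ k with j ≠ i; (ii) c_i ~ j for all 1 ≤ i ≤ k-1 and all j ∈ {0, k, k+1, …, 3k-2}; (iii) b_i ~ j for all 0 ≤ i ≤ k-1 and j ∈ {1,…,k-1}, and b_k ~ j for all j ∈ {2k,…,3k-2}; (iv) b_i ~ k+i-1 for 1 ≤ i ≤ k, and b_0 ~ 0. Then Z(G) = 4k - 2; in particular, no set of 4k - 3 vertices is a zero forcing set of G. -/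
open SimpleGraph Matrix


/-- In the standard zero forcing process, a blue vertex `u` (in `B`) forces its unique
white neighbor `v`. -/
def StdForce {V : Type*} (G : SimpleGraph V) (B : Set V) (u v : V) : Prop :=
  u ∈ B ∧ v ∉ B ∧ G.Adj u v ∧ ∀ w, G.Adj u w → w ∉ B → w = v

/-- A set of blue vertices is closed (stalled) when no standard force is possible. -/
def ZFClosed {V : Type*} (G : SimpleGraph V) (B : Set V) : Prop :=
  ∀ u v, StdForce G B u v → v ∈ B

/-- `S` is a zero forcing set: iterating the color change rule from `S` colors every
vertex blue; equivalently, the only stalled superset of `S` is the whole vertex set. -/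
def IsZeroForcingSet {V : Type*} (G : SimpleGraph V) (S : Set V) : Prop :=
  ∀ B : Set V, S ⊆ B → ZFClosed G B → B = Set.univ

/-- The zero forcing number `Z(G)`. -/
noncomputable def zfNum {V : Type*} (G : SimpleGraph V) [Fintype V] : ℕ :=
  sInf {n | ∃ S : Finset V, IsZeroForcingSet G ↑S ∧ S.card = n}

/-- The vertex set of the graph `G`: the circulant part `H` (= `ℤ/(3k-1)`), the clique
`A` (vertices `a_0, …, a_k`), the coclique `B` (vertices `b_0, …, b_k`) and the coclique
`C` (vertices `c_1, …, c_{k-1}`). -/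
abbrev GMVertex (k : ℕ) : Type :=
  ZMod (3 * k - 1) ⊕ (Fin (k + 1) ⊕ (Fin (k + 1) ⊕ Fin (k - 1)))

/-- The defining relation of the graph `G` (symmetrized by `fromRel`):
within `H` the circulant adjacency; `A` is a clique; `B` and `C` are cocliques;
(i) `a_i ∼ b_j` for `i ≠ j`; (ii) `c_i ∼ j` for `j ∈ {0, k, k+1, …, 3k-2}`;
(iii) `b_i ∼ j` for `i < k`, `j ∈ {1, …, k-1}` and `b_k ∼ j` for `j ∈ {2k, …, 3k-2}`;
(iv) `b_i ∼ k+i-1` for `1 ≤ i ≤ k` and `b_0 ∼ 0`. -/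
def gmRel (k : ℕ) : GMVertex k → GMVertex k → Prop
  | Sum.inl i, Sum.inl j =>
      ∃ t : ℕ, k ≤ t ∧ t ≤ 2 * k - 1 ∧ j = i + (t : ZMod (3 * k - 1))
  | Sum.inr (Sum.inl _), Sum.inr (Sum.inl _) => True
  | Sum.inr (Sum.inl i), Sum.inr (Sum.inr (Sum.inl j)) => (i : ℕ) ≠ (j : ℕ)
  | Sum.inr (Sum.inr (Sum.inl i)), Sum.inl j =>
      ((i : ℕ) < k ∧ ∃ t : ℕ, 1 ≤ t ∧ t ≤ k - 1 ∧ j = (t : ZMod (3 * k - 1))) ∨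
      ((i : ℕ) = k ∧ ∃ t : ℕ, 2 * k ≤ t ∧ t ≤ 3 * k - 2 ∧ j = (t : ZMod (3 * k - 1))) ∨
      (1 ≤ (i : ℕ) ∧ j = ((k + (i : ℕ) - 1 : ℕ) : ZMod (3 * k - 1))) ∨
      ((i : ℕ) = 0 ∧ j = 0)
  | Sum.inr (Sum.inr (Sum.inr _)), Sum.inl j =>
      j = 0 ∨ ∃ t : ℕ, k ≤ t ∧ t ≤ 3 * k - 2 ∧ j = (t : ZMod (3 * k - 1))
  | _, _ => False

/-- The `2k`-regular graph `G` of order `6k` from the construction. -/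
def gmGraph (k : ℕ) : SimpleGraph (GMVertex k) := SimpleGraph.fromRel (gmRel k)

/-- The defining relation of the Godsil–McKay switch `G'` of `G` with respect to the
switching set `X = V(A) ∪ V(H)`: all adjacencies inside `X` and inside `B ∪ C` are kept,
while every vertex of `B ∪ C` exchanges its neighbors in `X` for its non-neighbors
in `X`. -/
def gmRel' (k : ℕ) : GMVertex k → GMVertex k → Prop
  | Sum.inl i, Sum.inl j =>
      ∃ t : ℕ, k ≤ t ∧ t ≤ 2 * k - 1 ∧ j = i + (t : ZMod (3 * k - 1))
  | Sum.inr (Sum.inl _), Sum.inr (Sum.inl _) => True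
  | Sum.inr (Sum.inl i), Sum.inr (Sum.inr (Sum.inl j)) => (i : ℕ) = (j : ℕ)
  | Sum.inr (Sum.inl _), Sum.inr (Sum.inr (Sum.inr _)) => True
  | Sum.inr (Sum.inr (Sum.inl i)), Sum.inl j =>
      ¬ (((i : ℕ) < k ∧ ∃ t : ℕ, 1 ≤ t ∧ t ≤ k - 1 ∧ j = (t : ZMod (3 * k - 1))) ∨
        ((i : ℕ) = k ∧ ∃ t : ℕ, 2 * k ≤ t ∧ t ≤ 3 * k - 2 ∧ j = (t : ZMod (3 * k - 1))) ∨
        (1 ≤ (i : ℕ) ∧ j = ((k + (i : ℕ) - 1 : ℕ) : ZMod (3 * k - 1))) ∨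
        ((i : ℕ) = 0 ∧ j = 0))
  | Sum.inr (Sum.inr (Sum.inr _)), Sum.inl j =>
      ¬ (j = 0 ∨ ∃ t : ℕ, k ≤ t ∧ t ≤ 3 * k - 2 ∧ j = (t : ZMod (3 * k - 1)))
  | _, _ => False

/-- The Godsil–McKay switch `G'` of `G` with respect to `X = V(A) ∪ V(H)`. -/
def gmGraph' (k : ℕ) : SimpleGraph (GMVertex k) := SimpleGraph.fromRel (gmRel' k)

/-- Coordinates on the vertices of the graph `G` for `k = n + 1`. -/
inductive GMCoord (n : ℕ) : Type
  | z | w | b₀ | bₖ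
  | e (q : Fin n) | t (q : Fin n) | l (q : Fin n) | h (q : Fin n)
  | a (i : Fin (n + 2)) | c (q : Fin n)

namespace GMCoord

variable {n : ℕ}

/-- Half of the adjacency relation of `G` in coordinates. -/
def Edge : GMCoord n → GMCoord n → Prop
  | bₖ, w => True
  | bₖ, h _ => True
  | b₀, z => True
  | b₀, t _ => True
  | e _, t _ => True
  | t _, w => True
  | z, w => True
  | z, l _ => True
  | e q, l s => q = s
  | t q, l s => (q : ℕ) < s
  | t q, h p => (p : ℕ) ≤ q
  | l s, h p => (s : ℕ) ≤ p
  | _, _ => False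

/-- Numerical constraints satisfied by the indicator `X` of the vertices that have already
forced and the indicator `Y` of the white vertices. -/
structure Valid (X Y : GMCoord n → ℕ) : Prop where
  self : ∀ v, X v + Y v ≤ 1
  edge : ∀ u v, Edge u v → X u + Y v ≤ 1 ∧ X v + Y u ≤ 1
  a_le : ∑ i, X (a i) ≤ 2 ∧ ∑ i, Y (a i) ≤ 2
  a_pos : 1 ≤ ∑ i, X (a i) →
    ∑ i, Y (a i) = 0 ∧ ∑ i, X (a i) + Y b₀ + Y bₖ + ∑ q, Y (e q) ≤ 2
  b_pos : 1 ≤ X b₀ + X bₖ + ∑ q, X (e q) → ∑ i, Y (a i) ≤ 1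
  b_two : 2 ≤ X b₀ + X bₖ + ∑ q, X (e q) → ∑ i, Y (a i) = 0
  c_le : ∑ q, X (c q) ≤ 1 ∧ ∑ q, Y (c q) ≤ 1
  c_z : X z + ∑ q, Y (c q) ≤ 1 ∧ ∑ q, X (c q) + Y z ≤ 1
  c_w : X w + ∑ q, Y (c q) ≤ 1 ∧ ∑ q, X (c q) + Y w ≤ 1
  c_l : ∀ s, X (l s) + ∑ q, Y (c q) ≤ 1 ∧ ∑ q, X (c q) + Y (l s) ≤ 1
  c_h : ∀ s, X (h s) + ∑ q, Y (c q) ≤ 1 ∧ ∑ q, X (c q) + Y (h s) ≤ 1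
  total : 2 * n + 5 ≤
    ∑ q, (X (e q) + Y (e q) + X (t q) + Y (t q) + X (l q) + Y (l q) + X (h q) + Y (h q)) +
    (X b₀ + Y b₀ + X z + Y z + X w + Y w + X bₖ + Y bₖ) +
    (∑ i, X (a i) + ∑ i, Y (a i)) + (∑ q, X (c q) + ∑ q, Y (c q))

theorem sum_le_mul {f : Fin n → ℕ} {m : ℕ} (hf : ∀ q, f q ≤ m) : ∑ q, f q ≤ m * n := by
  have := Finset.sum_le_card_nsmul Finset.univ f m (fun q _ => hf q)
  simpa [mul_comm] using this

theorem sum_lt_mul {f : Fin n → ℕ} {m : ℕ} (hf : ∀ q, f q ≤ m) (q₀ : Fin n) (h₀ : f q₀ < m) :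
    ∑ q, f q < m * n := by
  have := Finset.sum_lt_sum (s := Finset.univ) (fun q _ => hf q) ⟨q₀, Finset.mem_univ _, h₀⟩
  simpa [mul_comm] using this

theorem sum_le_mul_add_one {f : Fin n → ℕ} {m : ℕ} (q₀ : Fin n) (hf : ∀ q, q ≠ q₀ → f q ≤ m)
    (h₀ : f q₀ ≤ m + 1) : ∑ q, f q ≤ m * n + 1 := by
  have h₁ : ∑ q, f q ≤ ∑ q, (m + if q = q₀ then 1 else 0) := by
    refine Finset.sum_le_sum fun q _ => ?_
    by_cases hq : q = q₀
    · subst hq; simpa using h₀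
    · simpa [hq] using hf q hq
  simpa [Finset.sum_add_distrib, mul_comm] using h₁

namespace Valid

variable {X Y : GMCoord n → ℕ}

theorem base (hv : Valid X Y) :
    (X z + Y z ≤ 1 ∧ X w + Y w ≤ 1 ∧ X b₀ + Y b₀ ≤ 1 ∧ X bₖ + Y bₖ ≤ 1) ∧
    (X bₖ + Y w ≤ 1 ∧ X w + Y bₖ ≤ 1) ∧ (X b₀ + Y z ≤ 1 ∧ X z + Y b₀ ≤ 1) ∧
    (X z + Y w ≤ 1 ∧ X w + Y z ≤ 1) :=
  ⟨⟨hv.self _, hv.self _, hv.self _, hv.self _⟩, hv.edge bₖ w trivial, hv.edge b₀ z trivial,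
    hv.edge z w trivial⟩

theorem column (hv : Valid X Y) (q : Fin n) :
    (X (e q) + Y (e q) ≤ 1 ∧ X (t q) + Y (t q) ≤ 1 ∧ X (l q) + Y (l q) ≤ 1 ∧
      X (h q) + Y (h q) ≤ 1) ∧
    (X bₖ + Y (h q) ≤ 1 ∧ X (h q) + Y bₖ ≤ 1) ∧ (X b₀ + Y (t q) ≤ 1 ∧ X (t q) + Y b₀ ≤ 1) ∧
    (X (t q) + Y w ≤ 1 ∧ X w + Y (t q) ≤ 1) ∧ (X z + Y (l q) ≤ 1 ∧ X (l q) + Y z ≤ 1) ∧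
    (X (e q) + Y (t q) ≤ 1 ∧ X (t q) + Y (e q) ≤ 1) ∧
    (X (e q) + Y (l q) ≤ 1 ∧ X (l q) + Y (e q) ≤ 1) ∧
    (X (t q) + Y (h q) ≤ 1 ∧ X (h q) + Y (t q) ≤ 1) ∧
    (X (l q) + Y (h q) ≤ 1 ∧ X (h q) + Y (l q) ≤ 1) :=
  ⟨⟨hv.self _, hv.self _, hv.self _, hv.self _⟩, hv.edge bₖ (h q) trivial,
    hv.edge b₀ (t q) trivial, hv.edge (t q) w trivial, hv.edge z (l q) trivial,
    hv.edge (e q) (t q) trivial, hv.edge (e q) (l q) rfl, hv.edge (t q) (h q) (le_refl (q : ℕ)),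
    hv.edge (l q) (h q) (le_refl (q : ℕ))⟩

theorem cross (hv : Valid X Y) (q s : Fin n) :
    (X (e q) + Y (t s) ≤ 1 ∧ X (t s) + Y (e q) ≤ 1) ∧
    ((q : ℕ) < s → X (t q) + Y (l s) ≤ 1 ∧ X (l s) + Y (t q) ≤ 1) ∧
    ((s : ℕ) ≤ q → X (t q) + Y (h s) ≤ 1 ∧ X (h s) + Y (t q) ≤ 1) ∧
    ((q : ℕ) ≤ s → X (l q) + Y (h s) ≤ 1 ∧ X (h s) + Y (l q) ≤ 1) :=
  ⟨hv.edge (e q) (t s) trivial, hv.edge (t q) (l s), hv.edge (t q) (h s), hv.edge (l q) (h s)⟩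

theorem total' (hv : Valid X Y) : 2 * n + 5 ≤
    ∑ q, (X (e q) + X (t q) + Y (t q) + X (l q) + Y (l q) + X (h q) + Y (h q)) +
    ∑ q, Y (e q) + (X b₀ + Y b₀ + X z + Y z + X w + Y w + X bₖ + Y bₖ) +
    (∑ i, X (a i) + ∑ i, Y (a i)) + (∑ q, X (c q) + ∑ q, Y (c q)) := by
  have := hv.total
  simp only [Finset.sum_add_distrib] at this ⊢
  omega

theorem sum_e_pos {q : Fin n} (hq : X (e q) = 1) : 1 ≤ ∑ q, X (e q) :=
  hq ▸ Finset.single_le_sum (f := fun q => X (e q)) (fun _ _ => Nat.zero_le _) (Finset.mem_univ q)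

theorem sum_c_pos {q : Fin n} (hq : X (c q) = 1) : 1 ≤ ∑ q, X (c q) :=
  hq ▸ Finset.single_le_sum (f := fun q => X (c q)) (fun _ _ => Nat.zero_le _) (Finset.mem_univ q)

theorem sum_a_pos {i : Fin (n + 2)} (hi : X (a i) = 1) : 1 ≤ ∑ i, X (a i) :=
  hi ▸ Finset.single_le_sum (f := fun q => X (a q)) (fun _ _ => Nat.zero_le _) (Finset.mem_univ i)

theorem total_le (hv : Valid X Y) (m : ℕ) (hm : ∀ q,
    X (e q) + Y (e q) + X (t q) + Y (t q) + X (l q) + Y (l q) + X (h q) + Y (h q) ≤ m) :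
    2 * n + 5 ≤ m * n + (X b₀ + Y b₀ + X z + Y z + X w + Y w + X bₖ + Y bₖ) +
    (∑ i, X (a i) + ∑ i, Y (a i)) + (∑ q, X (c q) + ∑ q, Y (c q)) := by
  have h₁ := hv.total
  have h₂ := sum_le_mul hm
  omega

theorem total_lt (hv : Valid X Y) (m : ℕ) (hm : ∀ q,
    X (e q) + Y (e q) + X (t q) + Y (t q) + X (l q) + Y (l q) + X (h q) + Y (h q) ≤ m)
    (q : Fin n) (hq :
    X (e q) + Y (e q) + X (t q) + Y (t q) + X (l q) + Y (l q) + X (h q) + Y (h q) < m) :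
    2 * n + 6 ≤ m * n + (X b₀ + Y b₀ + X z + Y z + X w + Y w + X bₖ + Y bₖ) +
    (∑ i, X (a i) + ∑ i, Y (a i)) + (∑ q, X (c q) + ∑ q, Y (c q)) := by
  have h₁ := hv.total
  have h₂ := sum_lt_mul hm q hq
  omega

theorem total_succ (hv : Valid X Y) (m : ℕ) (q₀ : Fin n) (hm : ∀ q, q ≠ q₀ →
    X (e q) + Y (e q) + X (t q) + Y (t q) + X (l q) + Y (l q) + X (h q) + Y (h q) ≤ m)
    (h₀ : X (e q₀) + Y (e q₀) + X (t q₀) + Y (t q₀) + X (l q₀) + Y (l q₀) + X (h q₀) + Y (h q₀)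
      ≤ m + 1) :
    2 * n + 4 ≤ m * n + (X b₀ + Y b₀ + X z + Y z + X w + Y w + X bₖ + Y bₖ) +
    (∑ i, X (a i) + ∑ i, Y (a i)) + (∑ q, X (c q) + ∑ q, Y (c q)) := by
  have h₁ := hv.total
  have h₂ := sum_le_mul_add_one q₀ hm h₀
  omega

theorem total_le' (hv : Valid X Y) (m : ℕ) (hm : ∀ q,
    X (e q) + X (t q) + Y (t q) + X (l q) + Y (l q) + X (h q) + Y (h q) ≤ m) :
    2 * n + 5 ≤ m * n + ∑ q, Y (e q) +
    (X b₀ + Y b₀ + X z + Y z + X w + Y w + X bₖ + Y bₖ) +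
    (∑ i, X (a i) + ∑ i, Y (a i)) + (∑ q, X (c q) + ∑ q, Y (c q)) := by
  have h₁ := hv.total'
  have h₂ := sum_le_mul hm
  omega

theorem sum_eq_zero {ι : Type*} [Fintype ι] {f : ι → ℕ} (hf : ∀ q, f q = 0) : ∑ q, f q = 0 :=
  Finset.sum_eq_zero fun q _ => hf q

/-- No two of the vertices of `X` in the circulant part outside `t` are adjacent. -/
structure Indep (X : GMCoord n → ℕ) : Prop where
  zw : X z + X w ≤ 1
  zl : ∀ q, X z + X (l q) ≤ 1
  lh : ∀ q s : Fin n, (q : ℕ) ≤ s → X (l q) + X (h s) ≤ 1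

/-- `X` vanishes on the vertices `z`, `w`, `l`, `h`. -/
structure NoR (X : GMCoord n → ℕ) : Prop where
  z : X z = 0
  w : X w = 0
  l : ∀ q, X (l q) = 0
  h : ∀ q, X (h q) = 0

/-- `X` vanishes on the vertices `b₀` and `e`. -/
structure NoE (X : GMCoord n → ℕ) : Prop where
  b₀ : X b₀ = 0
  e : ∀ q, X (e q) = 0

/-- `X` takes the value one on some vertex `b₀` or `e`. -/
def HasE (X : GMCoord n → ℕ) : Prop := X b₀ = 1 ∨ ∃ q, X (e q) = 1

theorem HasE.t_eq_zero (hE : HasE X) (hv : Valid X Y) (q : Fin n) : Y (t q) = 0 := by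
  rcases hE with hE | ⟨s, hs⟩
  · have := hv.column q; omega
  · have := hv.cross s q; omega

theorem HasE.pos (hE : HasE X) : 1 ≤ X b₀ + ∑ q, X (e q) := by
  rcases hE with hE | ⟨s, hs⟩
  · omega
  · have := sum_e_pos hs; omega

theorem NoR.indep (hR : NoR X) (hv : Valid X Y) : Indep X where
  zw := by have := hv.base; have := hR.z; omega
  zl q := by have := hv.base; have := hR.l q; omega
  lh q s _ := by have := hv.column s; have := hR.l q; omega

theorem t_e_eq_zero (hv : Valid X Y) {q : Fin n} (hq : X (t q) = 1) :
    (∀ s, Y (e s) = 0) ∧ Y b₀ = 0 ∧ Y w = 0 := by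
  refine ⟨fun s => ?_, ?_, ?_⟩
  · have := hv.cross s q; omega
  · have := hv.column q; omega
  · have := hv.column q; omega

theorem false_of_e_bₖ (hv : Valid X Y) (hE : HasE X) (hk : X bₖ = 1) (hT : ∀ q, X (t q) = 0)
    (hC : ∀ q, X (c q) = 0) (hI : Indep X) (hn : 1 ≤ n) (hA : (∀ i, X (a i) = 0) ∨ NoR X) :
    False := by
  have hC' := sum_eq_zero hC
  have hp := hE.pos
  have hb := hv.base
  have h₂ := hv.b_two (by omega)
  have h₃ := hv.c_le
  rcases hA with hA | hR
  · have hA' := sum_eq_zero hA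
    have := hv.total_le 2 fun q => by
      have := hv.column q
      have := hE.t_eq_zero hv q
      have := hT q
      have := hI.lh q q le_rfl
      omega
    have := hI.zw
    omega
  · have := hR.z
    have := hR.w
    have := hv.total_le' 1 fun q => by
      have := hv.column q
      have := hE.t_eq_zero hv q
      have := hT q
      have := hR.l q
      have := hR.h q
      omega
    by_cases hA : 1 ≤ ∑ i, X (a i)
    · have := hv.a_pos hA
      omega
    · have := hv.total_le 2 fun q => by
        have := hv.column q
        have := hE.t_eq_zero hv q
        have := hT q
        have := hR.l q
        have := hR.h q
        omega
      omega

theorem false_of_a_c (hv : Valid X Y) (hn : 1 ≤ n) {i : Fin (n + 2)} (hA : X (a i) = 1)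
    {q : Fin n} (hC : X (c q) = 1) (hT : ∀ q, X (t q) = 0) (hw : X w = 0) (hh : ∀ q, X (h q) = 0)
    (hs : (∀ q, X (l q) = 0) ∧ X b₀ + X bₖ + X z ≤ 1 ∨
      X b₀ + X bₖ = 0 ∧ ∑ q, X (l q) ≤ 1) : False := by
  have := sum_a_pos hA
  have := sum_c_pos hC
  have := hv.a_pos ‹_›
  have := hv.c_le
  have := hv.c_z
  have := hv.c_w
  have hb := hv.base
  have h₁ : ∑ q, (X (e q) + X (t q) + Y (t q) + Y (l q) + X (h q) + Y (h q)) ≤ 1 * n :=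
    sum_le_mul fun q => by
      have := hv.column q
      have := hT q
      have := hh q
      have := hv.c_l q
      have := hv.c_h q
      omega
  have h₂ := hv.total'
  simp only [Finset.sum_add_distrib] at h₁ h₂
  rcases hs with hs | hs
  · have := sum_eq_zero hs.1
    omega
  · by_cases hl : ∑ q, X (l q) = 0
    · omega
    · obtain ⟨s, -, hs'⟩ := Finset.exists_ne_zero_of_sum_ne_zero hl
      have := hv.c_l s
      omega

theorem false_of_e_c (hv : Valid X Y) (hn : 1 ≤ n) (hE : HasE X) (hA : ∀ i, X (a i) = 0)
    {q : Fin n} (hC : X (c q) = 1) (hT : ∀ q, X (t q) = 0) (hR : NoR X) : False := by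
  have := sum_c_pos hC
  have := sum_eq_zero hA
  have := hE.pos
  have := hv.b_pos (by omega)
  have := hv.c_le
  have := hv.c_z
  have := hv.c_w
  have hb := hv.base
  have := hR.z
  have := hR.w
  have := hv.total_le 1 fun q => by
    have := hv.column q
    have := hT q
    have := hR.l q
    have := hR.h q
    have := hE.t_eq_zero hv q
    have := hv.c_l q
    have := hv.c_h q
    omega
  omega

theorem false_of_e_c_l (hv : Valid X Y) (hE : HasE X) (hA : ∀ i, X (a i) = 0)
    {q₀ : Fin n} (hC : X (c q₀) = 1) (hT : ∀ q, X (t q) = 0) (hw : X w = 0)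
    (hh : ∀ q, X (h q) = 0) (hk : X bₖ = 0) {q₁ : Fin n} (hl : ∀ q, q ≠ q₁ → X (l q) = 0)
    (hzl : 1 ≤ X z + X (l q₁)) (hs : X b₀ = 0 ∨ ∀ q, X (e q) = 0) : False := by
  have := sum_c_pos hC
  have := sum_eq_zero hA
  have := hE.pos
  have := hv.b_pos (by omega)
  have := hv.c_le
  have := hv.c_z
  have := hv.c_w
  have := hv.c_l q₁
  have hb := hv.base
  have hn : 0 < n := q₁.pos
  have key : ∀ q, q ≠ q₁ → X (e q) + Y (e q) + X (t q) + Y (t q) + X (l q) + Y (l q) + X (h q)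
      + Y (h q) ≤ 1 := fun q hq => by
    have := hv.column q
    have := hT q
    have := hl q hq
    have := hh q
    have := hE.t_eq_zero hv q
    have := hv.c_l q
    have := hv.c_h q
    omega
  have h₁ := hv.column q₁
  have h₂ := hT q₁
  have h₃ := hh q₁
  have h₄ := hE.t_eq_zero hv q₁
  have h₅ := hv.c_h q₁
  by_cases hz : X z = 1
  · by_cases hl₁ : X (l q₁) = 1
    · rcases hs with hs | hs
      · have := hv.total_succ 1 q₁ key (by omega)
        omega
      · have := hs q₁
        have := hv.total_le 1 fun q => if hq : q = q₁ then by subst hq; omega else key q hq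
        omega
    · have := hv.total_le 1 fun q => if hq : q = q₁ then by subst hq; omega else key q hq
      omega
  · have := hv.total_succ 1 q₁ key (by omega)
    omega

theorem false_of_c_r (hv : Valid X Y) (hn : 1 ≤ n) {q₀ : Fin n} (hC : X (c q₀) = 1)
    (hA : ∀ i, X (a i) = 0) (hE : NoE X) (hk : X bₖ = 0) (hT : ∀ q, X (t q) = 0)
    (hs : (∃ s : Fin n, 0 < (s : ℕ) ∧ X (l s) = 1 ∧ X w = 0) ∨ ((∃ s, X (h s) = 1) ∧ X w = 0) ∨
      (X w = 1 ∧ ∃ q, X (h q) = 0)) : False := by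
  have := sum_c_pos hC
  have := sum_eq_zero hA
  have := hE.b₀
  have := hv.a_le
  have := hv.c_le
  have := hv.c_z
  have := hv.c_w
  have hb := hv.base
  have key : ∀ q, X (e q) + Y (e q) + X (t q) + Y (t q) + X (l q) + Y (l q) + X (h q)
      + Y (h q) ≤ 2 := fun q => by
    have := hv.column q
    have := hT q
    have := hE.e q
    have := hv.c_l q
    have := hv.c_h q
    omega
  by_cases hh : ∃ s, X (h s) = 1 ∧ X w = 0
  · obtain ⟨s, hs, hw⟩ := hh
    have := hv.c_h s
    have := hv.column s
    have := hv.total_le 2 key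
    omega
  · push Not at hh
    rcases hs with ⟨s, hs, hl, hw⟩ | ⟨⟨s, hs⟩, hw⟩ | ⟨hw, s, hs⟩
    · have := hv.c_l s
      have := hv.total_lt 2 key ⟨0, hn⟩ (by
        have := hv.cross ⟨0, hn⟩ s
        have := hv.column ⟨0, hn⟩
        have := hT ⟨0, hn⟩
        have := hE.e ⟨0, hn⟩
        have := hv.c_l ⟨0, hn⟩
        have := hv.c_h ⟨0, hn⟩
        have : X (h ⟨0, hn⟩) ≠ 1 := fun h₁ => hh _ h₁ hw
        simp only at *
        omega)
      omega
    · exact hh s hs hw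
    · have := hv.total_lt 2 key s (by
        have := hv.column s
        have := hT s
        have := hE.e s
        have := hv.c_l s
        have := hv.c_h s
        omega)
      omega

theorem false_of_e_r_c (hv : Valid X Y) {q₀ : Fin n} (hC : X (c q₀) = 1)
    (hA : ∀ i, X (a i) = 0) (hE : HasE X) (hk : X bₖ = 0) (hT : ∀ q, X (t q) = 0)
    (hI : Indep X) (hs : (X z = 0 ∧ X w = 0) ∨ ∃ q, X (l q) = 0 ∧ X (h q) = 0) : False := by
  have := sum_c_pos hC
  have := sum_eq_zero hA
  have := hE.pos
  have := hv.b_pos (by omega)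
  have := hv.c_le
  have := hv.c_z
  have := hv.c_w
  have := hv.base
  have := hI.zw
  have key : ∀ q, X (e q) + Y (e q) + X (t q) + Y (t q) + X (l q) + Y (l q) + X (h q)
      + Y (h q) ≤ 2 := fun q => by
    have := hv.column q
    have := hT q
    have := hE.t_eq_zero hv q
    have := hI.lh q q le_rfl
    have := hv.c_l q
    have := hv.c_h q
    omega
  by_cases hr : (X z = 1 ∨ X w = 1) ∨ ∃ s, X (l s) = 1 ∨ X (h s) = 1
  · have : ∑ q, Y (c q) = 0 := by
      rcases hr with hr | ⟨s, hr⟩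
      · omega
      · have := hv.c_l s
        have := hv.c_h s
        omega
    rcases hs with hs | ⟨s, hs⟩
    · have := hv.total_le 2 key
      omega
    · have := hv.total_lt 2 key s (by
        have := hv.column s
        have := hT s
        have := hE.t_eq_zero hv s
        have := hv.c_l s
        have := hv.c_h s
        omega)
      omega
  · push Not at hr
    have := hv.total_le 1 fun q => by
      have := hv.column q
      have := hT q
      have := hE.t_eq_zero hv q
      have := hr.2 q
      have := hv.c_l q
      have := hv.c_h q
      omega
    have := Fin.pos q₀
    omega

theorem false_of_bₖ_c_r (hv : Valid X Y) {q₀ : Fin n} (hC : X (c q₀) = 1)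
    (hA : ∀ i, X (a i) = 0) (hE : NoE X) (hk : X bₖ = 1) (hT : ∀ q, X (t q) = 0)
    (hr : (X z = 1 ∨ X w = 1) ∨ ∃ s, X (l s) = 1 ∨ X (h s) = 1)
    (hs : X w = 0 ∨ ∀ q, X (h q) = 0) : False := by
  have := sum_c_pos hC
  have := sum_eq_zero hA
  have := hE.b₀
  have := hv.b_pos (by omega)
  have := hv.c_le
  have := hv.c_z
  have := hv.c_w
  have := hv.base
  have hn := Fin.pos q₀
  have : ∑ q, Y (c q) = 0 := by
    rcases hr with hr | ⟨s, hr⟩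
    · omega
    · have := hv.c_l s
      have := hv.c_h s
      omega
  by_cases hw : X w = 0
  · have := hv.total_le 2 fun q => by
      have := hv.column q
      have := hT q
      have := hE.e q
      have := hv.c_l q
      have := hv.c_h q
      omega
    omega
  · have hs := hs.resolve_left hw
    have := hv.total_le 1 fun q => by
      have := hv.column q
      have := hT q
      have := hE.e q
      have := hs q
      have := hv.c_l q
      have := hv.c_h q
      omega
    omega

theorem false_of_t_c (hv : Valid X Y) {q₀ q₂ : Fin n} (hC : X (c q₀) = 1)
    (hE : NoE X) (hA : ∀ i, X (a i) = 0) (hT : X (t q₂) = 1) (hw : X w = 0)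
    (hh : ∀ q, X (h q) = 0) {q₁ : Fin n} (hl : ∀ q, q ≠ q₁ → X (l q) = 0)
    (hs : X bₖ = 0 ∨ X z + X (l q₁) = 0)
    (hs' : X z + X (l q₁) ≤ 1 ∨ 2 ≤ n ∨ X bₖ + Y bₖ = 0) : False := by
  have := sum_c_pos hC
  have := sum_eq_zero hA
  have := hE.b₀
  have := hv.b_pos
  have := hv.a_le
  have := hv.c_le
  have := hv.c_z
  have := hv.c_w
  have := hv.c_l q₁
  have := hv.base
  have := hv.t_e_eq_zero hT
  have hn := Fin.pos q₀
  have h₁ : ∀ q, X (e q) + Y (e q) + X (t q) + Y (t q) + X (l q) + Y (l q) + X (h q) + Y (h q)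
      ≤ 1 + X (l q) := fun q => by
    have := hv.column q
    have := (hv.t_e_eq_zero hT).1 q
    have := hE.e q
    have := hh q
    have := hv.c_l q
    have := hv.c_h q
    omega
  have h₂ : ∀ q, q ≠ q₁ → X (e q) + Y (e q) + X (t q) + Y (t q) + X (l q) + Y (l q) + X (h q)
      + Y (h q) ≤ 1 := fun q hq => by
    have := h₁ q
    have := hl q hq
    omega
  have h₃ := h₁ q₁
  by_cases hl₁ : X (l q₁) = 0
  · have := hv.total_le 1 fun q => if hq : q = q₁ then by subst hq; omega else h₂ q hq
    omega
  · have := hv.total_succ 1 q₁ h₂ (by omega)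
    omega

theorem false_of_a_t (hv : Valid X Y) {i : Fin (n + 2)} {q₀ : Fin n} (hA : X (a i) = 1)
    (hT : X (t q₀) = 1) (hC : ∀ q, X (c q) = 0) (hE : NoE X) (hR : NoR X)
    (hk : X bₖ = 0) : False := by
  have := sum_a_pos hA
  have := hv.a_pos this
  have := sum_eq_zero hC
  have := hv.c_le
  have := hv.base
  have := hv.t_e_eq_zero hT
  have := hR.z
  have := hR.w
  have := hE.b₀
  have := hv.total_le' 2 fun q => by
    have := hv.column q
    have := hv.cross q₀ q
    have := hE.e q
    have := hR.l q
    have := hR.h q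
    omega
  omega

theorem false_of_e_t (hv : Valid X Y) {q₀ : Fin n} (hE : HasE X) (hT : X (t q₀) = 1)
    (hT' : ∀ q, q ≠ q₀ → X (t q) = 0) (hC : ∀ q, X (c q) = 0) (hk : X bₖ = 0)
    (hI : Indep X) (hA : (∀ i, X (a i) = 0) ∨ NoR X) : False := by
  have := sum_eq_zero hC
  have := hv.c_le
  have hb := hv.base
  have h₀ := hv.t_e_eq_zero hT
  have hn := Fin.pos q₀
  have hp := hE.pos
  have h₁ := hv.b_pos (by omega)
  have h₂ := hv.b_two
  have h₃ := hI.zw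
  have key : ∀ q, X (e q) + Y (e q) + Y (t q) + X (l q) + Y (l q) + X (h q) + Y (h q) ≤ 2 :=
    fun q => by
    have := hv.column q
    have := hv.cross q₀ q
    have := hE.t_eq_zero hv q
    have := hI.lh q q le_rfl
    have := h₀.1 q
    omega
  have h₄ : ∑ q, X (t q) ≤ 0 * n + 1 :=
    sum_le_mul_add_one q₀ (fun q hq => (hT' q hq).le) (by omega)
  have h₅ := hv.total
  have hE' := sum_eq_zero h₀.1
  have key₁ := sum_le_mul key
  have key₂ : X (e ⟨0, hn⟩) + X (l ⟨0, hn⟩) + X (h ⟨0, hn⟩) ≤ 1 →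
      ∑ q, (X (e q) + Y (e q) + Y (t q) + X (l q) + Y (l q) + X (h q) + Y (h q)) < 2 * n :=
    fun hle => sum_lt_mul key ⟨0, hn⟩ (by
      have := hv.column ⟨0, hn⟩
      have := hv.cross q₀ ⟨0, hn⟩
      have := hE.t_eq_zero hv ⟨0, hn⟩
      have := h₀.1 ⟨0, hn⟩
      simp only at *
      omega)
  simp only [Finset.sum_add_distrib] at h₅ key₁ key₂
  by_cases hR : NoR X
  · have := hR.z
    have := hR.w
    have := key₂ (by
      have := hv.column ⟨0, hn⟩
      have := hR.l ⟨0, hn⟩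
      have := hR.h ⟨0, hn⟩
      omega)
    by_cases hA' : 1 ≤ ∑ i, X (a i)
    · have := hv.a_pos hA'
      omega
    · omega
  · have hA' := sum_eq_zero (hA.resolve_right hR)
    have hr : (X z = 1 ∨ X w = 1) ∨ ∃ s, X (l s) = 1 ∨ X (h s) = 1 := by
      by_contra hr
      push Not at hr
      refine hR ⟨by omega, by omega, fun q => ?_, fun q => ?_⟩
      · have := hv.column q; have := hr.2 q; omega
      · have := hv.column q; have := hr.2 q; omega
    have : ∑ q, Y (c q) = 0 := by
      have := hv.c_z
      have := hv.c_w
      rcases hr with hr | ⟨s, hr⟩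
      · omega
      · have := hv.c_l s
        have := hv.c_h s
        omega
    by_cases hw : X w = 1
    · omega
    by_cases hh : ∃ s, X (h s) = 1
    · obtain ⟨s, hs⟩ := hh
      have := hv.column s
      omega
    push Not at hh
    by_cases hB : X b₀ = 1 ∧ ∑ q, X (e q) = 0
    · have := key₂ (by
        have := hv.column ⟨0, hn⟩
        have := hh ⟨0, hn⟩
        have := (Finset.sum_eq_zero_iff.1 hB.2) ⟨0, hn⟩ (Finset.mem_univ _)
        omega)
      omega
    · omega

theorem false_of_t_r (hv : Valid X Y) {q₀ : Fin n} (hT : X (t q₀) = 1)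
    (hC : ∀ q, X (c q) = 0) (hk : X bₖ = 0) (hE : NoE X)
    (hI : Indep X) (hA : ∀ i, X (a i) = 0)
    (hr : (X z = 1 ∨ X w = 1) ∨ ∃ s, X (l s) = 1 ∨ X (h s) = 1) : False := by
  have := sum_eq_zero hC
  have := sum_eq_zero hA
  have := hv.a_le
  have := hv.base
  have h₀ := hv.t_e_eq_zero hT
  have := hI.zw
  have := hE.b₀
  have : ∑ q, Y (c q) = 0 := by
    have := hv.c_z
    have := hv.c_w
    rcases hr with hr | ⟨s, hr⟩
    · omega
    · have := hv.c_l s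
      have := hv.c_h s
      omega
  have := hv.total_le 2 fun q => by
    have := hv.column q
    have := hv.cross q₀ q
    have := hI.lh q q le_rfl
    have := h₀.1 q
    have := hE.e q
    omega
  omega

theorem false_of_bₖ_t (hv : Valid X Y) {q₀ : Fin n} (hT : X (t q₀) = 1)
    (hC : ∀ q, X (c q) = 0) (hk : X bₖ = 1) (hE : NoE X) (hA : ∀ i, X (a i) = 0)
    (hz : X z = 0) (hw : X w = 0) (hh : ∀ q, X (h q) = 0) : False := by
  have := sum_eq_zero hC
  have := sum_eq_zero hA
  have := hv.c_le
  have := hv.b_pos (by omega)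
  have := hv.base
  have h₀ := hv.t_e_eq_zero hT
  have := hE.b₀
  have := hv.total_le 2 fun q => by
    have := hv.column q
    have := h₀.1 q
    have := hE.e q
    have := hh q
    omega
  omega

theorem false_of_t_t (hv : Valid X Y) {q₀ q₁ : Fin n} (hlt : (q₀ : ℕ) < q₁) (hT : X (t q₀) = 1)
    (hT' : X (t q₁) = 1) (hC : ∀ q, X (c q) = 0) (hk : X bₖ = 0) (hE : NoE X)
    (hA : ∀ i, X (a i) = 0) (hR : NoR X) : False := by
  have := sum_eq_zero hC
  have := sum_eq_zero hA
  have := hv.a_le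
  have := hv.c_le
  have := hv.base
  have h₀ := hv.t_e_eq_zero hT
  have := hE.b₀
  have := hR.z
  have := hR.w
  have key : ∀ q, X (e q) + Y (e q) + X (t q) + Y (t q) + X (l q) + Y (l q) + X (h q) + Y (h q)
      ≤ 2 := fun q => by
    have := hv.column q
    have := hv.cross q₀ q
    have := h₀.1 q
    have := hE.e q
    have := hR.h q
    have := hR.l q
    omega
  have := hv.total_lt 2 key q₁ (by
    have := hv.column q₁
    have := hv.cross q₀ q₁
    have := h₀.1 q₁
    have := hE.e q₁
    have := hR.h q₁
    have := hR.l q₁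
    omega)
  omega

theorem false_of_a_bₖ_t (hv : Valid X Y) {i : Fin (n + 2)} (hA : X (a i) = 1) {q₀ : Fin n}
    (hT : X (t q₀) = 1) (hC : ∀ q, X (c q) = 0) (hk : X bₖ = 1) (hE : NoE X) (hR : NoR X)
    (hs : ∑ i, X (a i) ≤ 1 ∨ Y z = 0 ∨
      ∃ q, X (t q) + Y (t q) + X (l q) + Y (l q) ≤ 1) : False := by
  have := sum_a_pos hA
  have := hv.a_le
  have := hv.a_pos ‹_›
  have := sum_eq_zero hC
  have := hv.c_le
  have := hv.base
  have h₀ := hv.t_e_eq_zero hT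
  have := sum_eq_zero h₀.1
  have := hE.b₀
  have := hR.z
  have := hR.w
  have key : ∀ q, X (e q) + Y (e q) + X (t q) + Y (t q) + X (l q) + Y (l q) + X (h q) + Y (h q)
      ≤ 2 := fun q => by
    have := hv.column q
    have := h₀.1 q
    have := hE.e q
    have := hR.h q
    have := hR.l q
    omega
  rcases hs with hs | hs | ⟨q, hq⟩
  · have := hv.total_le 2 key
    omega
  · have := hv.total_le 2 key
    omega
  · have := hv.total_lt 2 key q (by
      have := hv.column q
      have := h₀.1 q
      have := hE.e q
      have := hR.h q
      omega)
    omega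

theorem false_of_a_bₖ_r (hv : Valid X Y) {i : Fin (n + 2)} (hA : X (a i) = 1)
    (hT : ∀ q, X (t q) = 0) (hC : ∀ q, X (c q) = 0) (hk : X bₖ = 1) (hE : NoE X)
    (hI : Indep X) (hr : (X z = 1 ∨ X w = 1) ∨ ∃ s, X (l s) = 1 ∨ X (h s) = 1) : False := by
  have := sum_a_pos hA
  have := hv.a_pos ‹_›
  have := sum_eq_zero hC
  have := hv.base
  have := hE.b₀
  have := hI.zw
  have : ∑ q, Y (c q) = 0 := by
    have := hv.c_z
    have := hv.c_w
    rcases hr with hr | ⟨s, hr⟩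
    · omega
    · have := hv.c_l s
      have := hv.c_h s
      omega
  have := hv.total_le' 2 fun q => by
    have := hv.column q
    have := hT q
    have := hE.e q
    have := hI.lh q q le_rfl
    omega
  omega

theorem false_of_a_r (hv : Valid X Y) {i : Fin (n + 2)} (hA : X (a i) = 1)
    (hT : ∀ q, X (t q) = 0) (hC : ∀ q, X (c q) = 0) (hk : X bₖ = 0)
    (hI : Indep X) (hr : (X z = 1 ∨ X w = 1) ∨ ∃ s, X (l s) = 1 ∨ X (h s) = 1) : False := by
  have := sum_a_pos hA
  have := hv.a_pos ‹_›
  have := sum_eq_zero hC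
  have := hv.base
  have := hI.zw
  have : ∑ q, Y (c q) = 0 := by
    have := hv.c_z
    have := hv.c_w
    rcases hr with hr | ⟨s, hr⟩
    · omega
    · have := hv.c_l s
      have := hv.c_h s
      omega
  have := hv.total_le' 2 fun q => by
    have := hv.column q
    have := hT q
    have := hI.lh q q le_rfl
    have := hI.zl q
    by_cases hE : HasE X
    · have := hE.t_eq_zero hv q
      omega
    · have : X (e q) = 0 := by
        by_contra hq
        exact hE (Or.inr ⟨q, by omega⟩)
      rcases hr with hr | ⟨s, hr⟩
      · omega
      · have := hv.column s
        have := hv.cross q s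
        have := hv.cross s q
        have := hI.lh s q
        have := hI.lh q s
        omega
  omega

theorem false_of_bₖ_r (hv : Valid X Y) (hA : ∀ i, X (a i) = 0)
    (hT : ∀ q, X (t q) = 0) (hC : ∀ q, X (c q) = 0) (hk : X bₖ = 1) (hE : NoE X)
    (hr : (X z = 1 ∨ X w = 1) ∨ ∃ s, X (h s) = 1) : False := by
  have := sum_eq_zero hA
  have := sum_eq_zero hC
  have := hv.b_pos (by omega)
  have := hv.base
  have := hE.b₀
  have : ∑ q, Y (c q) = 0 := by
    have := hv.c_z
    have := hv.c_w
    rcases hr with hr | ⟨s, hr⟩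
    · omega
    · have := hv.c_h s
      omega
  have := hv.total_le 2 fun q => by
    have := hv.column q
    have := hT q
    have := hE.e q
    rcases hr with hr | ⟨s, hr⟩
    · omega
    · have := hv.cross q s
      have := hv.cross s q
      omega
  omega

theorem false_of_conflict (hv : Valid X Y) (hA : ∀ i, X (a i) = 0)
    (hT : ∀ q, X (t q) = 0) (hC : ∀ q, X (c q) = 0) (hk : X bₖ = 0) (hI : ¬ Indep X)
    (hs : (∀ q s : Fin n, (q : ℕ) ≤ s → X (l q) + X (h s) ≤ 1) ∨
      (X z + X w ≤ 1 ∧ ∃ q₀, ∀ q, q ≠ q₀ → X (l q) + X (h q) ≤ 1)) : False := by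
  have hA' := sum_eq_zero hA
  have := sum_eq_zero hC
  have hb := hv.base
  have := hv.a_le
  have hcz := hv.c_z
  have hcw := hv.c_w
  have hEE : HasE X ∨ NoE X := by
    by_cases hE : HasE X
    · exact Or.inl hE
    · unfold HasE at hE
      push Not at hE
      exact Or.inr ⟨by omega, fun q => by have := hv.column q; have := hE.2 q; omega⟩
  have hEA : HasE X → ∑ i, Y (a i) ≤ 1 := fun hE => hv.b_pos (by have := hE.pos; omega)
  by_cases hlh : ∀ q s : Fin n, (q : ℕ) ≤ s → X (l q) + X (h s) ≤ 1
  · by_cases hzw : X z + X w ≤ 1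
    · have hzl : ∃ q, X z = 1 ∧ X (l q) = 1 := by
        by_contra hzl
        push Not at hzl
        exact hI ⟨hzw, fun q => by have := hv.column q; have := hzl q; omega, hlh⟩
      obtain ⟨s, hz, hl⟩ := hzl
      have := hv.total_le 2 fun q => by
        have := hv.column q
        have := hT q
        have := hlh q q le_rfl
        have := hlh s q
        have := hv.cross q s
        have := hv.cross s q
        rcases hEE with hE | hE
        · have := hE.t_eq_zero hv q
          omega
        · have := hE.e q
          omega
      rcases hEE with hE | hE
      · have := hEA hE
        omega
      · have := hE.b₀
        omega
    · have := hv.total_le 2 fun q => by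
        have := hv.column q
        have := hT q
        have := hlh q q le_rfl
        rcases hEE with hE | hE
        · have := hE.t_eq_zero hv q
          omega
        · have := hE.e q
          omega
      rcases hEE with hE | hE
      · have := hEA hE
        omega
      · have := hE.b₀
        omega
  · obtain ⟨hzw, q₀, hq₀⟩ := hs.resolve_left hlh
    push Not at hlh
    obtain ⟨s, p, hsp, hlh⟩ := hlh
    have hcl := hv.c_l s
    have hs₁ := hv.column s
    have hp₁ := hv.column p
    rcases hEE with hE | hE
    · have := hEA hE
      have := hv.total_succ 2 q₀ (fun q hq => by
        have := hv.column q
        have := hT q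
        have := hq₀ q hq
        have := hv.cross s q
        have := hv.cross q p
        have := hE.t_eq_zero hv q
        omega) (by
        have := hv.column q₀
        have := hT q₀
        have := hv.cross s q₀
        have := hv.cross q₀ p
        have := hE.t_eq_zero hv q₀
        omega)
      omega
    · have := hE.b₀
      have := hv.total_le 2 fun q => by
        have := hv.column q
        have := hT q
        have := hE.e q
        have := hv.cross s q
        have := hv.cross q s
        have := hv.cross q p
        have := hv.cross p q
        omega
      omega
theorem indep_of_zl (hv : Valid X Y) (hz : X z = 0) (hl : ∀ q, X (l q) = 0) : Indep X where
  zw := by have := hv.base; omega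
  zl q := by have := hl q; omega
  lh q s _ := by have := hv.column s; have := hl q; omega

theorem indep_of_wl (hv : Valid X Y) (hw : X w = 0) (hl : ∀ q, X (l q) = 0) : Indep X where
  zw := by have := hv.base; omega
  zl q := by have := hv.base; have := hl q; omega
  lh q s _ := by have := hv.column s; have := hl q; omega

theorem indep_of_zh (hv : Valid X Y) (hz : X z = 0) (hh : ∀ q, X (h q) = 0) : Indep X where
  zw := by have := hv.base; omega
  zl q := by have := hv.column q; omega
  lh q s _ := by have := hv.column q; have := hh s; omega

theorem noR_or (hv : Valid X Y) :
    NoR X ∨ ((X z = 1 ∨ X w = 1) ∨ ∃ s, X (l s) = 1 ∨ X (h s) = 1) := by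
  by_contra hr
  push Not at hr
  have := hv.base
  refine hr.1 ⟨by omega, by omega, fun q => ?_, fun q => ?_⟩
  · have := hv.column q; have := hr.2.2 q; omega
  · have := hv.column q; have := hr.2.2 q; omega

theorem hasE_or (hv : Valid X Y) : HasE X ∨ NoE X := by
  by_cases hE : HasE X
  · exact Or.inl hE
  · unfold HasE at hE
    push Not at hE
    have := hv.base
    exact Or.inr ⟨by omega, fun q => by have := hv.column q; have := hE.2 q; omega⟩

theorem noA_or (hv : Valid X Y) : (∀ i, X (a i) = 0) ∨ ∃ i, X (a i) = 1 := by
  by_contra hA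
  push Not at hA
  obtain ⟨⟨i, hi⟩, hA⟩ := hA
  have := hv.self (a i)
  have := hA i
  omega

/-- The sets of forcing vertices that can occur in a forcing process starting from `4k - 3` blue
vertices. -/
inductive Fam (X : GMCoord n → ℕ) : Prop
  | ae (hR : NoR X) (hk : X bₖ = 0) (hT : ∀ q, X (t q) = 0) (hC : ∀ q, X (c q) = 0)
  | ak (hE : NoE X) (hR : NoR X) (hk : X bₖ = 1) (hT : ∀ q, X (t q) = 0)
      (hC : ∀ q, X (c q) = 0)
  | er (hA : ∀ i, X (a i) = 0) (hI : Indep X) (hk : X bₖ = 0) (hT : ∀ q, X (t q) = 0)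
      (hC : ∀ q, X (c q) = 0)
  | kl (hA : ∀ i, X (a i) = 0) (hE : NoE X) (hz : X z = 0) (hw : X w = 0)
      (hh : ∀ q, X (h q) = 0) (hk : X bₖ = 1) (hT : ∀ q, X (t q) = 0) (hC : ∀ q, X (c q) = 0)
  | t (q₀ : Fin n) (hT : X (t q₀) = 1) (hT' : ∀ q, q ≠ q₀ → X (t q) = 0)
      (hA : ∀ i, X (a i) = 0) (hE : NoE X) (hR : NoR X) (hk : X bₖ = 0) (hC : ∀ q, X (c q) = 0)
  | c (q₀ : Fin n) (hC : X (c q₀) = 1) (hA : ∀ i, X (a i) = 0) (hE : NoE X) (hw : X w = 0)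
      (hl : ∀ q : Fin n, 0 < (q : ℕ) → X (l q) = 0) (hh : ∀ q, X (h q) = 0) (hk : X bₖ = 0)
      (hT : ∀ q, X (t q) = 0)
  | ck (q₀ : Fin n) (hC : X (c q₀) = 1) (hA : ∀ i, X (a i) = 0) (hE : NoE X) (hR : NoR X)
      (hk : X bₖ = 1) (hT : ∀ q, X (t q) = 0)

/-- The change of the configuration when `u` forces `v`. -/
structure Step (X Y X' Y' : GMCoord n → ℕ) (u v : GMCoord n) : Prop where
  left : Valid X Y
  right : Valid X' Y'
  u_eq : X u = 0
  u_eq' : X' u = 1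
  ne : ∀ x, x ≠ u → X' x = X x
  v_eq : Y v = 1
  v_eq' : Y' v = 0
  vu : v ≠ u
  of_c : ∀ q, u = .c q → v = .z ∨ v = .w ∨ (∃ s, v = .l s) ∨ ∃ s, v = .h s
  of_t : ∀ q, u = .t q → v = .b₀ ∨ v = .bₖ ∨ (∃ s, v = .e s) ∨ v = .z ∨ v = .w ∨
    (∃ s, v = .l s) ∨ (∃ s, v = .h s) ∨ ∃ s, v = .t s

variable {X' Y' : GMCoord n → ℕ} {u v : GMCoord n}

theorem Step.fam_er (hs : Step X Y X' Y' u v) (hn : 1 ≤ n) (hA : ∀ i, X (GMCoord.a i) = 0)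
    (hI : Indep X)
    (hk : X bₖ = 0) (hT : ∀ q, X (GMCoord.t q) = 0) (hC : ∀ q, X (GMCoord.c q) = 0) :
    Fam X' := by
  have hu := hs.u_eq'
  have hne := hs.ne
  have hv := hs.left
  have hv' := hs.right
  have zw := hI.zw
  have zl := hI.zl
  have lh := hI.lh
  cases u with
  | z =>
    by_cases hI' : Indep X'
    · exact .er (by simp [*]) hI' (by simp [*]) (by simp [*]) (by simp [*])
    · exact (hv'.false_of_conflict (by simp [*]) (by simp [*]) (by simp [*]) (by simp [*]) hI'
        (Or.inl (by simpa [hne] using lh))).elim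
  | w =>
    by_cases hI' : Indep X'
    · exact .er (by simp [*]) hI' (by simp [*]) (by simp [*]) (by simp [*])
    · exact (hv'.false_of_conflict (by simp [*]) (by simp [*]) (by simp [*]) (by simp [*]) hI'
        (Or.inl (by simpa [hne] using lh))).elim
  | l s =>
    by_cases hI' : Indep X'
    · exact .er (by simp [*]) hI' (by simp [*]) (by simp [*]) (by simp [*])
    · exact (hv'.false_of_conflict (by simp [*]) (by simp [*]) (by simp [*]) (by simp [*]) hI'
        (Or.inr ⟨by simpa [hne] using zw, s, fun q hq => by
          simpa [hne, hq] using lh q q le_rfl⟩)).elim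
  | h s =>
    by_cases hI' : Indep X'
    · exact .er (by simp [*]) hI' (by simp [*]) (by simp [*]) (by simp [*])
    · exact (hv'.false_of_conflict (by simp [*]) (by simp [*]) (by simp [*]) (by simp [*]) hI'
        (Or.inr ⟨by simpa [hne] using zw, s, fun q hq => by
          simpa [hne, hq] using lh q q le_rfl⟩)).elim
  | b₀ =>
    exact .er (by simp [*]) ⟨by simpa [hne] using zw, by simpa [hne] using zl,
      by simpa [hne] using lh⟩ (by simp [*]) (by simp [*]) (by simp [*])
  | e q =>
    exact .er (by simp [*]) ⟨by simpa [hne] using zw, by simpa [hne] using zl,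
      by simpa [hne] using lh⟩ (by simp [*]) (by simp [*]) (by simp [*])
  | a i =>
    rcases hv'.noR_or with hR | hr
    · exact .ae hR (by simp [*]) (by simp [*]) (by simp [*])
    · exact (hv'.false_of_a_r hu (by simp [*]) (by simp [*]) (by simp [*])
        ⟨by simpa [hne] using zw, by simpa [hne] using zl, by simpa [hne] using lh⟩ hr).elim
  | bₖ =>
    rcases hv'.hasE_or with hE | hE
    · exact (hv'.false_of_e_bₖ hE hu (by simp [*]) (by simp [*])
        ⟨by simpa [hne] using zw, by simpa [hne] using zl, by simpa [hne] using lh⟩ hn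
        (Or.inl (by simp [*]))).elim
    · by_cases hr : (X' GMCoord.z = 1 ∨ X' w = 1) ∨ ∃ s, X' (h s) = 1
      · exact (hv'.false_of_bₖ_r (by simp [*]) (by simp [*]) (by simp [*]) hu hE hr).elim
      · push Not at hr
        have := hv'.base
        exact .kl (by simp [*]) hE (by omega) (by omega)
          (fun q => by have := hv'.column q; have := hr.2 q; omega) hu (by simp [*]) (by simp [*])
  | t q =>
    have hI' : Indep X' :=
      ⟨by simpa [hne] using zw, by simpa [hne] using zl, by simpa [hne] using lh⟩
    have hT' : ∀ s, s ≠ q → X' (GMCoord.t s) = 0 := fun s hs => by simp [*]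
    rcases hv'.hasE_or with hE | hE
    · exact (hv'.false_of_e_t hE hu hT' (by simp [*]) (by simp [*]) hI'
        (Or.inl (by simp [*]))).elim
    · rcases hv'.noR_or with hR | hr
      · exact .t q hu hT' (by simp [*]) hE hR (by simp [*]) (by simp [*])
      · exact (hv'.false_of_t_r hu (by simp [*]) (by simp [*]) hE hI' (by simp [*]) hr).elim
  | c q =>
    have hI' : Indep X' :=
      ⟨by simpa [hne] using zw, by simpa [hne] using zl, by simpa [hne] using lh⟩
    have hb := hv.base
    have hY := hs.v_eq
    have hnew : (X' GMCoord.z = 0 ∧ X' w = 0) ∨ ∃ q, X' (l q) = 0 ∧ X' (h q) = 0 := by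
      simp only [hne, ne_eq, reduceCtorEq, not_false_eq_true]
      rcases hs.of_c q rfl with rfl | rfl | ⟨s, rfl⟩ | ⟨s, rfl⟩
      · left; omega
      · left; omega
      · have := hv.column s
        exact Or.inr ⟨s, by omega, by omega⟩
      · have := hv.column s
        exact Or.inr ⟨s, by omega, by omega⟩
    have hA' : ∀ i, X' (GMCoord.a i) = 0 := by simp [*]
    have hk' : X' bₖ = 0 := by simp [*]
    have hT' : ∀ i, X' (GMCoord.t i) = 0 := by simp [*]
    rcases hv'.hasE_or with hE | hE
    · exact (hv'.false_of_e_r_c hu hA' hE hk' hT' hI' hnew).elim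
    · have hb' := hv'.base
      by_cases hw : X' w = 0
      · by_cases hh : ∃ s, X' (h s) = 1
        · exact (hv'.false_of_c_r hn hu hA' hE hk' hT' (Or.inr (Or.inl ⟨hh, hw⟩))).elim
        · by_cases hl : ∃ s : Fin n, 0 < (s : ℕ) ∧ X' (l s) = 1 ∧ X' w = 0
          · exact (hv'.false_of_c_r hn hu hA' hE hk' hT' (Or.inl hl)).elim
          · push Not at hh hl
            exact .c q hu hA' hE hw
              (fun s hs => by have := hv'.column s; have := hl s hs; omega)
              (fun s => by have := hv'.column s; have := hh s; omega) hk' hT'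
      · refine (hv'.false_of_c_r hn hu hA' hE hk' hT' (Or.inr (Or.inr ⟨by omega, ?_⟩))).elim
        rcases hnew with hnew | ⟨s, hs⟩
        · omega
        · exact ⟨s, hs.2⟩

theorem Step.fam_ae (hs : Step X Y X' Y' u v) (hn : 1 ≤ n) (hR : NoR X) (hk : X bₖ = 0)
    (hT : ∀ q, X (t q) = 0) (hC : ∀ q, X (c q) = 0) : Fam X' := by
  have hu := hs.u_eq'
  have hne := hs.ne
  have hv := hs.left
  have hv' := hs.right
  rcases hv.noA_or with hA | ⟨i, hA⟩
  · exact hs.fam_er hn hA (hR.indep hv) hk hT hC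
  obtain ⟨z0, w0, l0, h0⟩ := hR
  cases u with
  | z =>
    exact (hv'.false_of_a_r (i := i) (by simp [*]) (by simp [*]) (by simp [*]) (by simp [*])
      (hv'.indep_of_wl (by simp [*]) (by simp [*])) (Or.inl (Or.inl hu))).elim
  | w =>
    exact (hv'.false_of_a_r (i := i) (by simp [*]) (by simp [*]) (by simp [*]) (by simp [*])
      (hv'.indep_of_zl (by simp [*]) (by simp [*])) (Or.inl (Or.inr hu))).elim
  | l s =>
    exact (hv'.false_of_a_r (i := i) (by simp [*]) (by simp [*]) (by simp [*]) (by simp [*])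
      (hv'.indep_of_zh (by simp [*]) (by simp [*])) (Or.inr ⟨s, Or.inl hu⟩)).elim
  | h s =>
    exact (hv'.false_of_a_r (i := i) (by simp [*]) (by simp [*]) (by simp [*]) (by simp [*])
      (hv'.indep_of_zl (by simp [*]) (by simp [*])) (Or.inr ⟨s, Or.inr hu⟩)).elim
  | b₀ =>
    exact .ae ⟨by simp [*], by simp [*], by simp [*], by simp [*]⟩ (by simp [*])
      (by simp [*]) (by simp [*])
  | e q =>
    exact .ae ⟨by simp [*], by simp [*], by simp [*], by simp [*]⟩ (by simp [*])
      (by simp [*]) (by simp [*])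
  | a j =>
    exact .ae ⟨by simp [*], by simp [*], by simp [*], by simp [*]⟩ (by simp [*])
      (by simp [*]) (by simp [*])
  | bₖ =>
    have hR' : NoR X' := ⟨by simp [*], by simp [*], by simp [*], by simp [*]⟩
    rcases hv'.hasE_or with hE | hE
    · exact (hv'.false_of_e_bₖ hE hu (by simp [*]) (by simp [*]) (hR'.indep hv') hn
        (Or.inr hR')).elim
    · exact .ak hE hR' hu (by simp [*]) (by simp [*])
  | t q =>
    have hR' : NoR X' := ⟨by simp [*], by simp [*], by simp [*], by simp [*]⟩
    rcases hv'.hasE_or with hE | hE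
    · exact (hv'.false_of_e_t hE hu (fun s hs => by simp [*]) (by simp [*]) (by simp [*])
        (hR'.indep hv') (Or.inr hR')).elim
    · exact (hv'.false_of_a_t (i := i) (by simp [*]) hu (by simp [*]) hE hR' (by simp [*])).elim
  | c q =>
    refine (hv'.false_of_a_c hn (i := i) (by simp [*]) hu (by simp [*]) (by simp [*])
      (by simp [*]) (Or.inl ⟨by simp [*], ?_⟩)).elim
    have := hv'.base
    have : X' bₖ = 0 := by simp [*]
    have : X' z = 0 := by simp [*]
    omega

theorem Step.fam_kl (hs : Step X Y X' Y' u v) (hn : 1 ≤ n) (hA : ∀ i, X (a i) = 0) (hE : NoE X)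
    (hz : X z = 0) (hw : X w = 0) (hh : ∀ q, X (h q) = 0) (hk : X bₖ = 1)
    (hT : ∀ q, X (t q) = 0) (hC : ∀ q, X (c q) = 0) : Fam X' := by
  have hu := hs.u_eq'
  have hne := hs.ne
  have hu0 := hs.u_eq
  have hv := hs.left
  have hv' := hs.right
  obtain ⟨b0, e0⟩ := hE
  cases u with
  | z => exact (hv'.false_of_bₖ_r (by simp [*]) (by simp [*]) (by simp [*]) (by simp [*])
      ⟨by simp [*], by simp [*]⟩ (Or.inl (Or.inl hu))).elim
  | w => exact (hv'.false_of_bₖ_r (by simp [*]) (by simp [*]) (by simp [*]) (by simp [*])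
      ⟨by simp [*], by simp [*]⟩ (Or.inl (Or.inr hu))).elim
  | h s => exact (hv'.false_of_bₖ_r (by simp [*]) (by simp [*]) (by simp [*]) (by simp [*])
      ⟨by simp [*], by simp [*]⟩ (Or.inr ⟨s, hu⟩)).elim
  | l s =>
    exact .kl (by simp [*]) ⟨by simp [*], by simp [*]⟩ (by simp [*]) (by simp [*])
      (by simp [*]) (by simp [*]) (by simp [*]) (by simp [*])
  | b₀ =>
    exact (hv'.false_of_e_bₖ (Or.inl hu) (by simp [*]) (by simp [*]) (by simp [*])
      (hv'.indep_of_zh (by simp [*]) (by simp [*])) hn (Or.inl (by simp [*]))).elim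
  | e q =>
    exact (hv'.false_of_e_bₖ (Or.inr ⟨q, hu⟩) (by simp [*]) (by simp [*]) (by simp [*])
      (hv'.indep_of_zh (by simp [*]) (by simp [*])) hn (Or.inl (by simp [*]))).elim
  | bₖ => omega
  | a i =>
    rcases hv'.noR_or with hR | hr
    · exact .ak ⟨by simp [*], by simp [*]⟩ hR (by simp [*]) (by simp [*]) (by simp [*])
    · exact (hv'.false_of_a_bₖ_r hu (by simp [*]) (by simp [*]) (by simp [*])
        ⟨by simp [*], by simp [*]⟩ (hv'.indep_of_zh (by simp [*]) (by simp [*])) hr).elim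
  | t q =>
    exact (hv'.false_of_bₖ_t hu (by simp [*]) (by simp [*]) ⟨by simp [*], by simp [*]⟩
      (by simp [*]) (by simp [*]) (by simp [*]) (by simp [*])).elim
  | c q =>
    rcases hv'.noR_or with hR | hr
    · exact .ck q hu (by simp [*]) ⟨by simp [*], by simp [*]⟩ hR (by simp [*]) (by simp [*])
    · exact (hv'.false_of_bₖ_c_r hu (by simp [*]) ⟨by simp [*], by simp [*]⟩ (by simp [*])
        (by simp [*]) hr (Or.inl (by simp [*]))).elim

theorem Step.fam_ak (hs : Step X Y X' Y' u v) (hn : 1 ≤ n) (hE : NoE X) (hR : NoR X)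
    (hk : X bₖ = 1) (hT : ∀ q, X (t q) = 0) (hC : ∀ q, X (c q) = 0) : Fam X' := by
  have hu := hs.u_eq'
  have hne := hs.ne
  have hu0 := hs.u_eq
  have hv := hs.left
  have hv' := hs.right
  rcases hv.noA_or with hA | ⟨i, hA⟩
  · exact hs.fam_kl hn hA hE hR.z hR.w hR.h hk hT hC
  obtain ⟨z0, w0, l0, h0⟩ := hR
  obtain ⟨b0, e0⟩ := hE
  cases u with
  | z =>
    exact (hv'.false_of_a_bₖ_r (i := i) (by simp [*]) (by simp [*]) (by simp [*]) (by simp [*])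
      ⟨by simp [*], by simp [*]⟩
      (hv'.indep_of_wl (by simp [*]) (by simp [*])) (Or.inl (Or.inl hu))).elim
  | w =>
    exact (hv'.false_of_a_bₖ_r (i := i) (by simp [*]) (by simp [*]) (by simp [*]) (by simp [*])
      ⟨by simp [*], by simp [*]⟩
      (hv'.indep_of_zl (by simp [*]) (by simp [*])) (Or.inl (Or.inr hu))).elim
  | l s =>
    exact (hv'.false_of_a_bₖ_r (i := i) (by simp [*]) (by simp [*]) (by simp [*]) (by simp [*])
      ⟨by simp [*], by simp [*]⟩
      (hv'.indep_of_zh (by simp [*]) (by simp [*])) (Or.inr ⟨s, Or.inl hu⟩)).elim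
  | h s =>
    exact (hv'.false_of_a_bₖ_r (i := i) (by simp [*]) (by simp [*]) (by simp [*]) (by simp [*])
      ⟨by simp [*], by simp [*]⟩
      (hv'.indep_of_zl (by simp [*]) (by simp [*])) (Or.inr ⟨s, Or.inr hu⟩)).elim
  | b₀ =>
    have hR' : NoR X' := ⟨by simp [*], by simp [*], by simp [*], by simp [*]⟩
    exact (hv'.false_of_e_bₖ (Or.inl hu) (by simp [*]) (by simp [*]) (by simp [*])
      (hR'.indep hv') hn (Or.inr hR')).elim
  | e q =>
    have hR' : NoR X' := ⟨by simp [*], by simp [*], by simp [*], by simp [*]⟩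
    exact (hv'.false_of_e_bₖ (Or.inr ⟨q, hu⟩) (by simp [*]) (by simp [*]) (by simp [*])
      (hR'.indep hv') hn (Or.inr hR')).elim
  | a j =>
    exact .ak ⟨by simp [*], by simp [*]⟩ ⟨by simp [*], by simp [*], by simp [*], by simp [*]⟩
      (by simp [*]) (by simp [*]) (by simp [*])
  | bₖ => omega
  | t q =>
    have hR' : NoR X' := ⟨by simp [*], by simp [*], by simp [*], by simp [*]⟩
    refine (hv'.false_of_a_bₖ_t (i := i) (by simp [*]) hu (by simp [*]) (by simp [*])
      ⟨by simp [*], by simp [*]⟩ hR' ?_).elim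
    by_cases hA1 : ∑ i, X' (GMCoord.a i) ≤ 1
    · exact Or.inl hA1
    right
    have hAX : ∑ i, X (GMCoord.a i) = ∑ i, X' (GMCoord.a i) := by simp [hne]
    have := hv.a_pos (by omega)
    have hY := hs.v_eq
    have hb := hv.base
    rcases hs.of_t q rfl with rfl | rfl | ⟨s, rfl⟩ | rfl | rfl | ⟨s, rfl⟩ | ⟨s, rfl⟩ | ⟨s, rfl⟩
    · omega
    · omega
    · have := Finset.single_le_sum (f := fun q => Y (GMCoord.e q)) (fun _ _ => Nat.zero_le _)
        (Finset.mem_univ s)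
      omega
    · exact Or.inl hs.v_eq'
    · omega
    · have h1 := hv'.column s
      have := hs.v_eq'
      have : X' (GMCoord.l s) = 0 := by simp [*]
      exact Or.inr ⟨s, by omega⟩
    · have := hv.column s
      omega
    · have h1 := hv'.column s
      have := hs.v_eq'
      have hsq : GMCoord.t s ≠ GMCoord.t q := hs.vu
      have : X' (GMCoord.t s) = 0 := by simp only [hne _ hsq, hT]
      exact Or.inr ⟨s, by omega⟩
  | c q =>
    refine (hv'.false_of_a_c hn (i := i) (by simp [*]) hu (by simp [*]) (by simp [*])
      (by simp [*]) (Or.inl ⟨by simp [*], ?_⟩)).elim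
    simp [*]

theorem Step.fam_t (hs : Step X Y X' Y' u v) (q₀ : Fin n) (hT : X (t q₀) = 1)
    (hT' : ∀ q, q ≠ q₀ → X (t q) = 0)
    (hA : ∀ i, X (a i) = 0) (hE : NoE X) (hR : NoR X) (hk : X bₖ = 0) (hC : ∀ q, X (c q) = 0) :
    Fam X' := by
  have hu := hs.u_eq'
  have hne := hs.ne
  have hu0 := hs.u_eq
  have hv := hs.left
  have hv' := hs.right
  obtain ⟨z0, w0, l0, h0⟩ := hR
  obtain ⟨b0, e0⟩ := hE
  cases u with
  | z =>
    exact (hv'.false_of_t_r (q₀ := q₀) (by simp [*]) (by simp [*]) (by simp [*])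
      ⟨by simp [*], by simp [*]⟩ (hv'.indep_of_wl (by simp [*]) (by simp [*])) (by simp [*])
      (Or.inl (Or.inl hu))).elim
  | w =>
    exact (hv'.false_of_t_r (q₀ := q₀) (by simp [*]) (by simp [*]) (by simp [*])
      ⟨by simp [*], by simp [*]⟩ (hv'.indep_of_zl (by simp [*]) (by simp [*])) (by simp [*])
      (Or.inl (Or.inr hu))).elim
  | l s =>
    exact (hv'.false_of_t_r (q₀ := q₀) (by simp [*]) (by simp [*]) (by simp [*])
      ⟨by simp [*], by simp [*]⟩ (hv'.indep_of_zh (by simp [*]) (by simp [*])) (by simp [*])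
      (Or.inr ⟨s, Or.inl hu⟩)).elim
  | h s =>
    exact (hv'.false_of_t_r (q₀ := q₀) (by simp [*]) (by simp [*]) (by simp [*])
      ⟨by simp [*], by simp [*]⟩ (hv'.indep_of_zl (by simp [*]) (by simp [*])) (by simp [*])
      (Or.inr ⟨s, Or.inr hu⟩)).elim
  | b₀ =>
    have hR' : NoR X' := ⟨by simp [*], by simp [*], by simp [*], by simp [*]⟩
    exact (hv'.false_of_e_t (q₀ := q₀) (Or.inl hu) (by simp [*])
      (fun q hq => by simp [*]) (by simp [*]) (by simp [*])
      (hR'.indep hv') (Or.inr hR')).elim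
  | e q =>
    have hR' : NoR X' := ⟨by simp [*], by simp [*], by simp [*], by simp [*]⟩
    exact (hv'.false_of_e_t (q₀ := q₀) (Or.inr ⟨q, hu⟩) (by simp [*])
      (fun q hq => by simp [*]) (by simp [*]) (by simp [*])
      (hR'.indep hv') (Or.inr hR')).elim
  | a j =>
    exact (hv'.false_of_a_t (q₀ := q₀) hu (by simp [*]) (by simp [*]) ⟨by simp [*], by simp [*]⟩
      ⟨by simp [*], by simp [*], by simp [*], by simp [*]⟩ (by simp [*])).elim
  | bₖ =>
    exact (hv'.false_of_bₖ_t (q₀ := q₀) (by simp [*]) (by simp [*]) hu ⟨by simp [*], by simp [*]⟩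
      (by simp [*]) (by simp [*]) (by simp [*]) (by simp [*])).elim
  | t q =>
    have hq : q₀ ≠ q := by rintro rfl; omega
    have hq0 : X' (GMCoord.t q₀) = 1 := by simp [*]
    have hR' : NoR X' := ⟨by simp [*], by simp [*], by simp [*], by simp [*]⟩
    have hq' : (q₀ : ℕ) ≠ q := fun h => hq (Fin.ext h)
    rcases lt_or_gt_of_ne hq' with hlt | hlt
    · exact (hv'.false_of_t_t hlt hq0 hu (by simp [*]) (by simp [*]) ⟨by simp [*], by simp [*]⟩
        (by simp [*]) hR').elim
    · exact (hv'.false_of_t_t hlt hu hq0 (by simp [*]) (by simp [*]) ⟨by simp [*], by simp [*]⟩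
        (by simp [*]) hR').elim
  | c q =>
    exact (hv'.false_of_t_c (q₂ := q₀) (q₁ := q₀) hu ⟨by simp [*], by simp [*]⟩ (by simp [*])
      (by simp [*]) (by simp [*]) (by simp [*]) (by simp [*]) (Or.inl (by simp [*]))
      (Or.inl (by simp [*]))).elim

theorem Step.false_of_c_c (hs : Step X Y X' Y' u v) {q₀ q : Fin n} (hu : u = .c q)
    (hC : X (c q₀) = 1) : False := by
  subst hu
  have := hs.right.c_le.1
  have hu0 := hs.u_eq
  have hq : q ≠ q₀ := by rintro rfl; omega
  have h1 : X' (c q₀) = 1 := by rw [hs.ne _ (by simpa using hq.symm), hC]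
  have h2 := Finset.add_le_sum (f := fun i => X' (c i)) (s := Finset.univ)
    (fun _ _ => Nat.zero_le _) (Finset.mem_univ q) (Finset.mem_univ q₀) hq
  simp only [hs.u_eq', h1] at h2
  omega

theorem Step.fam_ck (hs : Step X Y X' Y' u v) (hn : 1 ≤ n) (q₀ : Fin n) (hC : X (c q₀) = 1)
    (hA : ∀ i, X (a i) = 0) (hE : NoE X) (hR : NoR X) (hk : X bₖ = 1) (hT : ∀ q, X (t q) = 0) :
    Fam X' := by
  have hu := hs.u_eq'
  have hne := hs.ne
  have hu0 := hs.u_eq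
  have hv := hs.left
  have hv' := hs.right
  obtain ⟨z0, w0, l0, h0⟩ := hR
  obtain ⟨b0, e0⟩ := hE
  cases u with
  | z =>
    exact (hv'.false_of_bₖ_c_r (q₀ := q₀) (by simp [*]) (by simp [*]) ⟨by simp [*], by simp [*]⟩
      (by simp [*]) (by simp [*]) (Or.inl (Or.inl hu)) (Or.inl (by simp [*]))).elim
  | w =>
    exact (hv'.false_of_bₖ_c_r (q₀ := q₀) (by simp [*]) (by simp [*]) ⟨by simp [*], by simp [*]⟩
      (by simp [*]) (by simp [*]) (Or.inl (Or.inr hu)) (Or.inr (by simp [*]))).elim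
  | l s =>
    exact (hv'.false_of_bₖ_c_r (q₀ := q₀) (by simp [*]) (by simp [*]) ⟨by simp [*], by simp [*]⟩
      (by simp [*]) (by simp [*]) (Or.inr ⟨s, Or.inl hu⟩) (Or.inl (by simp [*]))).elim
  | h s =>
    exact (hv'.false_of_bₖ_c_r (q₀ := q₀) (by simp [*]) (by simp [*]) ⟨by simp [*], by simp [*]⟩
      (by simp [*]) (by simp [*]) (Or.inr ⟨s, Or.inr hu⟩) (Or.inl (by simp [*]))).elim
  | b₀ =>
    exact (hv'.false_of_e_c hn (Or.inl hu) (by simp [*]) (q := q₀) (by simp [*]) (by simp [*])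
      ⟨by simp [*], by simp [*], by simp [*], by simp [*]⟩).elim
  | e q =>
    exact (hv'.false_of_e_c hn (Or.inr ⟨q, hu⟩) (by simp [*]) (q := q₀) (by simp [*]) (by simp [*])
      ⟨by simp [*], by simp [*], by simp [*], by simp [*]⟩).elim
  | a j =>
    exact (hv'.false_of_a_c hn hu (q := q₀) (by simp [*]) (by simp [*]) (by simp [*])
      (by simp [*]) (Or.inl ⟨by simp [*], by simp [*]⟩)).elim
  | bₖ => omega
  | t q =>
    exact (hv'.false_of_t_c (q₀ := q₀) (q₁ := q₀) (by simp [*]) ⟨by simp [*], by simp [*]⟩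
      (by simp [*]) hu (by simp [*]) (by simp [*]) (by simp [*]) (Or.inr (by simp [*]))
      (Or.inl (by simp [*]))).elim
  | c q => exact (hs.false_of_c_c rfl hC).elim

theorem Step.fam_c (hs : Step X Y X' Y' u v) (hn : 1 ≤ n) (q₀ : Fin n) (hC : X (c q₀) = 1)
    (hA : ∀ i, X (a i) = 0) (hE : NoE X) (hw : X w = 0)
    (hl : ∀ q : Fin n, 0 < (q : ℕ) → X (l q) = 0) (hh : ∀ q, X (h q) = 0) (hk : X bₖ = 0)
    (hT : ∀ q, X (t q) = 0) : Fam X' := by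
  have hu := hs.u_eq'
  have hne := hs.ne
  have hu0 := hs.u_eq
  have hv := hs.left
  have hv' := hs.right
  obtain ⟨b0, e0⟩ := hE
  have hl0 : ∀ q : Fin n, q ≠ ⟨0, hn⟩ → X (GMCoord.l q) = 0 := fun q hq =>
    hl q (Nat.pos_of_ne_zero fun h => hq (Fin.ext h))
  cases u with
  | z =>
    exact .c q₀ (by simp [*]) (by simp [*]) ⟨by simp [*], by simp [*]⟩ (by simp [*])
      (fun q hq => by simp [*]) (by simp [*]) (by simp [*]) (by simp [*])
  | w =>
    exact (hv'.false_of_c_r hn (q₀ := q₀) (by simp [*]) (by simp [*]) ⟨by simp [*], by simp [*]⟩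
      (by simp [*]) (by simp [*]) (Or.inr (Or.inr ⟨hu, q₀, by simp [*]⟩))).elim
  | l s =>
    rcases Nat.eq_zero_or_pos s with h0 | h0
    · refine .c q₀ (by simp [*]) (by simp [*]) ⟨by simp [*], by simp [*]⟩ (by simp [*])
        (fun q hq => ?_) (by simp [*]) (by simp [*]) (by simp [*])
      have : q ≠ s := by rintro rfl; omega
      simp [*]
    · exact (hv'.false_of_c_r hn (q₀ := q₀) (by simp [*]) (by simp [*]) ⟨by simp [*], by simp [*]⟩
        (by simp [*]) (by simp [*]) (Or.inl ⟨s, h0, hu, by simp [*]⟩)).elim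
  | h s =>
    exact (hv'.false_of_c_r hn (q₀ := q₀) (by simp [*]) (by simp [*]) ⟨by simp [*], by simp [*]⟩
      (by simp [*]) (by simp [*]) (Or.inr (Or.inl ⟨⟨s, hu⟩, by simp [*]⟩))).elim
  | b₀ =>
    by_cases hzl : 1 ≤ X' z + X' (GMCoord.l ⟨0, hn⟩)
    · exact (hv'.false_of_e_c_l (q₀ := q₀) (q₁ := ⟨0, hn⟩) (Or.inl hu) (by simp [*]) (by simp [*])
        (by simp [*]) (by simp [*]) (by simp [*]) (by simp [*])
        (fun q hq => by rw [hne _ (by simp)]; exact hl0 q hq) hzl (Or.inr (by simp [*]))).elim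
    · refine (hv'.false_of_e_c hn (q := q₀) (Or.inl hu) (by simp [*]) (by simp [*]) (by simp [*])
        ⟨by omega, by simp [*], fun q => ?_, by simp [*]⟩).elim
      by_cases hq : q = ⟨0, hn⟩
      · subst hq; omega
      · rw [hne _ (by simp)]; exact hl0 q hq
  | e q =>
    by_cases hzl : 1 ≤ X' z + X' (GMCoord.l ⟨0, hn⟩)
    · exact (hv'.false_of_e_c_l (q₀ := q₀) (q₁ := ⟨0, hn⟩) (Or.inr ⟨q, hu⟩) (by simp [*])
        (by simp [*]) (by simp [*]) (by simp [*]) (by simp [*]) (by simp [*])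
        (fun q hq => by rw [hne _ (by simp)]; exact hl0 q hq) hzl (Or.inl (by simp [*]))).elim
    · refine (hv'.false_of_e_c hn (q := q₀) (Or.inr ⟨q, hu⟩) (by simp [*]) (by simp [*])
        (by simp [*]) ⟨by omega, by simp [*], fun q => ?_, by simp [*]⟩).elim
      by_cases hq : q = ⟨0, hn⟩
      · subst hq; omega
      · rw [hne _ (by simp)]; exact hl0 q hq
  | a j =>
    refine (hv'.false_of_a_c hn hu (q := q₀) (by simp [*]) (by simp [*]) (by simp [*])
      (by simp [*]) (Or.inr ⟨by simp [*], ?_⟩)).elim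
    have := sum_le_mul_add_one (f := fun q => X' (GMCoord.l q)) (m := 0) ⟨0, hn⟩
      (fun q hq => by simp only [hne (GMCoord.l q) (by simp), hl0 q hq, le_refl])
      (by have := hv'.column ⟨0, hn⟩; omega)
    simpa using this
  | bₖ =>
    rcases hv'.noR_or with hR | hr
    · exact .ck q₀ (by simp [*]) (by simp [*]) ⟨by simp [*], by simp [*]⟩ hR hu (by simp [*])
    · exact (hv'.false_of_bₖ_c_r (q₀ := q₀) (by simp [*]) (by simp [*]) ⟨by simp [*], by simp [*]⟩
        hu (by simp [*]) hr (Or.inl (by simp [*]))).elim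
  | t q =>
    refine (hv'.false_of_t_c (q₀ := q₀) (q₁ := ⟨0, hn⟩) (by simp [*]) ⟨by simp [*], by simp [*]⟩
      (by simp [*]) hu (by simp [*]) (by simp [*])
        (fun q hq => by rw [hne _ (by simp)]; exact hl0 q hq) (Or.inl (by simp [*])) ?_).elim
    by_cases h1 : X' z + X' (GMCoord.l ⟨0, hn⟩) ≤ 1
    · exact Or.inl h1
    by_cases h2 : 2 ≤ n
    · exact Or.inr (Or.inl h2)
    refine Or.inr (Or.inr ?_)
    obtain rfl : n = 1 := by omega
    have hc0 : 1 ≤ ∑ q, X (GMCoord.c q) := sum_c_pos hC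
    have hb := hv.base
    have hb' := hv'.base
    have hcz := hv.c_z
    have hcw := hv.c_w
    have hY := hs.v_eq
    have hz : X' z = X z := hne _ (by simp)
    have hlz : X' (GMCoord.l ⟨0, hn⟩) = X (GMCoord.l ⟨0, hn⟩) := hne _ (by simp)
    have hcol := hv.column ⟨0, hn⟩
    have hcol' := hv'.column ⟨0, hn⟩
    rcases hs.of_t q rfl with rfl | rfl | ⟨s, rfl⟩ | rfl | rfl | ⟨s, rfl⟩ | ⟨s, rfl⟩ | ⟨s, rfl⟩
    · omega
    · have := hs.v_eq'
      simp [*]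
    · obtain rfl : s = ⟨0, hn⟩ := Subsingleton.elim _ _
      omega
    · omega
    · omega
    · have := hv.c_l s
      omega
    · have := hv.c_h s
      omega
    · exact absurd (congrArg GMCoord.t (Subsingleton.elim s q)) hs.vu
  | c q => exact (hs.false_of_c_c rfl hC).elim

theorem Step.fam (hs : Step X Y X' Y' u v) (hn : 1 ≤ n) (hX : Fam X) : Fam X' := by
  cases hX with
  | ae hR hk hT hC => exact hs.fam_ae hn hR hk hT hC
  | ak hE hR hk hT hC => exact hs.fam_ak hn hE hR hk hT hC
  | er hA hI hk hT hC => exact hs.fam_er hn hA hI hk hT hC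
  | kl hA hE hz hw hh hk hT hC => exact hs.fam_kl hn hA hE hz hw hh hk hT hC
  | t q₀ hT hT' hA hE hR hk hC => exact hs.fam_t q₀ hT hT' hA hE hR hk hC
  | c q₀ hC hA hE hw hl hh hk hT => exact hs.fam_c hn q₀ hC hA hE hw hl hh hk hT
  | ck q₀ hC hA hE hR hk hT => exact hs.fam_ck hn q₀ hC hA hE hR hk hT

theorem not_fam (hv : Valid X Y) (hY : ∀ v, Y v = 0) : ¬ Fam X := by
  intro hX
  have ha := hv.a_le.1
  have hc := hv.c_le.1
  have ya := sum_eq_zero fun i => hY (a i)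
  have yc := sum_eq_zero fun i => hY (c i)
  have hb := hv.base
  have hcol := hv.column
  have y₁ := hY z
  have y₂ := hY w
  have y₃ := hY b₀
  have y₄ := hY bₖ
  have hYq : ∀ q, Y (e q) = 0 ∧ Y (GMCoord.t q) = 0 ∧ Y (l q) = 0 ∧ Y (h q) = 0 :=
    fun q => ⟨hY _, hY _, hY _, hY _⟩
  cases hX with
  | ae hR hk hT hC =>
    have := hv.total_le 1 fun q => by
      have := hYq q; have := hcol q; have := hR.l q; have := hR.h q; have := hT q; omega
    have := sum_eq_zero hC
    have := hR.z
    have := hR.w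
    omega
  | ak hE hR hk hT hC =>
    have := hv.total_le 1 fun q => by
      have := hYq q; have := hcol q; have := hR.l q; have := hR.h q; have := hT q; omega
    have := sum_eq_zero hC
    have := hR.z
    have := hR.w
    have := hE.b₀
    omega
  | er hA hI hk hT hC =>
    have := hv.total_le 2 fun q => by
      have := hYq q; have := hcol q; have := hI.lh q q le_rfl; have := hT q; omega
    have := sum_eq_zero hC
    have := sum_eq_zero hA
    omega
  | kl hA hE hz hw hh hk hT hC =>
    have := hv.total_le 1 fun q => by
      have := hYq q; have := hcol q; have := hE.e q; have := hh q; have := hT q; omega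
    have := sum_eq_zero hC
    omega
  | t q₀ hT hT' hA hE hR hk hC =>
    have := hv.total_le 1 fun q => by
      have := hYq q; have := hcol q; have := hE.e q; have := hR.l q; have := hR.h q; omega
    have := sum_eq_zero hC
    have := sum_eq_zero hA
    have := hE.b₀
    have := hR.z
    have := hR.w
    omega
  | c q₀ hC hA hE hw hl hh hk hT =>
    have := hv.total_le 1 fun q => by
      have := hYq q; have := hcol q; have := hE.e q; have := hh q; have := hT q; omega
    have := sum_eq_zero hA
    omega
  | ck q₀ hC hA hE hR hk hT =>
    have := hv.total_le 1 fun q => by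
      have := hYq q; have := hcol q; have := hE.e q; have := hR.l q; have := hT q; omega
    have := sum_eq_zero hA
    have := hE.b₀
    have := hR.z
    have := hR.w
    omega

end Valid
end GMCoord

section ZeroForcing

variable {V : Type*} {G : SimpleGraph V}

theorem IsZeroForcingSet.mono {S T : Set V} (hS : IsZeroForcingSet G S) (h : S ⊆ T) :
    IsZeroForcingSet G T := fun B hB hc => hS B (h.trans hB) hc

/-- A zero forcing set meets every nonempty set `F` such that no vertex outside `F` has exactly
one neighbor in `F`. -/
theorem IsZeroForcingSet.exists_mem_fort {S F : Set V} (hS : IsZeroForcingSet G S)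
    (hF : F.Nonempty)
    (h : ∀ u ∉ F, ∀ v ∈ F, G.Adj u v → ∃ w ∈ F, w ≠ v ∧ G.Adj u w) : ∃ x ∈ F, x ∈ S := by
  by_contra hx
  push Not at hx
  obtain ⟨x, hxF⟩ := hF
  have hB := hS Fᶜ (fun y hy hyF => hx y hyF hy) fun u v ⟨hu, hv, huv, hw⟩ => by
    obtain ⟨w, hwF, hne, hadj⟩ := h u hu v (not_not.1 hv) huv
    exact (hne (hw w hadj (not_not.2 hwF))).elim
  exact (hB ▸ Set.mem_univ x : x ∈ Fᶜ) hxF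

/-- Zero forcing sets are transported by graph isomorphisms. -/
theorem IsZeroForcingSet.preimage {W : Type*} {G' : SimpleGraph W} (φ : G ≃g G') {S : Set W}
    (hS : IsZeroForcingSet G' S) : IsZeroForcingSet G (φ ⁻¹' S) := by
  intro B hB hc
  have hB' := hS (φ.symm ⁻¹' B) (fun x hx => hB (by simpa using hx)) fun u v ⟨hu, hv, huv, hw⟩ =>
    hc _ _ ⟨hu, hv, φ.symm.map_adj_iff.2 huv, fun w hwu hwB => by
      have := hw (φ w) (by rw [← φ.symm.map_adj_iff]; simpa using hwu) (by simpa using hwB)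
      simp [← this]⟩
  refine Set.eq_univ_of_forall fun x => ?_
  have : φ x ∈ φ.symm ⁻¹' B := hB' ▸ Set.mem_univ _
  simpa using this

variable [DecidableEq V]

/-- `ForcingState G S U B`: starting from the blue set `S`, some sequence of forces leads to the
blue set `B`, where `U` is the set of vertices that have forced. -/
inductive ForcingState (G : SimpleGraph V) (S : Finset V) : Finset V → Finset V → Prop
  | start : ForcingState G S ∅ S
  | step {U B : Finset V} {u v : V} (h : ForcingState G S U B) (hf : StdForce G ↑B u v) :
      ForcingState G S (insert u U) (insert v B)

namespace ForcingState

variable {S U B : Finset V}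

theorem base_subset (h : ForcingState G S U B) : S ⊆ B := by
  induction h with
  | start => exact subset_rfl
  | step _ _ ih => exact ih.trans (Finset.subset_insert _ _)

theorem subset (h : ForcingState G S U B) : U ⊆ B := by
  induction h with
  | start => simp
  | step _ hf ih =>
    exact Finset.insert_subset (Finset.mem_insert_of_mem hf.1)
      (ih.trans (Finset.subset_insert _ _))

theorem mem_of_adj (h : ForcingState G S U B) {x y : V} (hx : x ∈ U) (hxy : G.Adj x y) :
    y ∈ B := by
  induction h with
  | start => simp at hx
  | @step U B u v _ hf ih =>
    rcases Finset.mem_insert.1 hx with rfl | hx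
    · by_cases hy : y ∈ B
      · exact Finset.mem_insert_of_mem hy
      · exact Finset.mem_insert.2 (Or.inl (hf.2.2.2 y hxy hy))
    · exact Finset.mem_insert_of_mem (ih hx)

theorem notMem_of_force (h : ForcingState G S U B) {u v : V} (hf : StdForce G ↑B u v) :
    u ∉ U := fun hu => hf.2.1 (h.mem_of_adj hu hf.2.2.1)

theorem card_eq (h : ForcingState G S U B) : B.card = S.card + U.card := by
  induction h with
  | start => simp
  | step h hf ih =>
    rw [Finset.card_insert_of_notMem (h.notMem_of_force hf),
      Finset.card_insert_of_notMem (by simpa using hf.2.1), ih, add_assoc]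

end ForcingState

/-- A zero forcing set admits a sequence of forces that colors every vertex blue. -/
theorem IsZeroForcingSet.exists_forcingState [Fintype V] {S : Finset V}
    (hS : IsZeroForcingSet G (S : Set V)) : ∃ U, ForcingState G S U Finset.univ := by
  classical
  obtain ⟨B, hB, hmax⟩ := Finset.exists_max_image
    (Finset.univ.filter fun B : Finset V => ∃ U, ForcingState G S U B) Finset.card
    ⟨S, by simpa using ⟨∅, ForcingState.start⟩⟩
  simp only [Finset.mem_filter, Finset.mem_univ, true_and] at hB hmax
  obtain ⟨U, hU⟩ := hB
  have := hS (B : Set V) (by exact_mod_cast hU.base_subset) fun u v hf => by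
    have hc := hmax _ ⟨_, hU.step hf⟩
    rw [Finset.card_insert_of_notMem (by simpa using hf.2.1)] at hc
    omega
  obtain rfl : B = Finset.univ := by exact_mod_cast this
  exact ⟨U, hU⟩

end ZeroForcing

namespace GMCoord

variable {n : ℕ}

/-- The coordinates as a disjoint union. -/
def equivSum (n : ℕ) :
    GMCoord n ≃ Fin 4 ⊕ Fin n ⊕ Fin n ⊕ Fin n ⊕ Fin n ⊕ Fin (n + 2) ⊕ Fin n where
  toFun
    | z => .inl 0
    | w => .inl 1
    | b₀ => .inl 2
    | bₖ => .inl 3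
    | e q => .inr (.inl q)
    | t q => .inr (.inr (.inl q))
    | l q => .inr (.inr (.inr (.inl q)))
    | h q => .inr (.inr (.inr (.inr (.inl q))))
    | a i => .inr (.inr (.inr (.inr (.inr (.inl i)))))
    | c q => .inr (.inr (.inr (.inr (.inr (.inr q)))))
  invFun
    | .inl 0 => z
    | .inl 1 => w
    | .inl 2 => b₀
    | .inl 3 => bₖ
    | .inr (.inl q) => e q
    | .inr (.inr (.inl q)) => t q
    | .inr (.inr (.inr (.inl q))) => l q
    | .inr (.inr (.inr (.inr (.inl q)))) => h q
    | .inr (.inr (.inr (.inr (.inr (.inl i))))) => a i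
    | .inr (.inr (.inr (.inr (.inr (.inr q))))) => c q
  left_inv v := by cases v <;> rfl
  right_inv v := by
    rcases v with v | v | v | v | v | v | v
    · fin_cases v <;> rfl
    all_goals rfl

instance : Fintype (GMCoord n) := Fintype.ofEquiv _ (equivSum n).symm

instance : DecidableEq (GMCoord n) := (equivSum n).decidableEq

theorem sum_eq (f : GMCoord n → ℕ) : ∑ v, f v =
    ∑ q, (f (e q) + f (t q) + f (l q) + f (h q)) + (f b₀ + f z + f w + f bₖ) +
      ∑ i, f (a i) + ∑ q, f (c q) := by
  rw [← (equivSum n).symm.sum_comp]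
  simp only [Fintype.sum_sum_type, Fin.sum_univ_four, Finset.sum_add_distrib]
  simp only [equivSum, Equiv.coe_fn_symm_mk]
  ring

theorem card_eq : Fintype.card (GMCoord n) = 6 * n + 6 := by
  rw [Fintype.card_congr (equivSum n)]
  simp only [Fintype.card_sum, Fintype.card_fin]
  ring

/-- The vertex of `G` with given coordinates. -/
def toVertex : GMCoord n → GMVertex (n + 1)
  | z => .inl (0 : ℕ)
  | t q => .inl ((q + 1 : ℕ))
  | l q => .inl ((n + 1 + q : ℕ))
  | w => .inl ((2 * n + 1 : ℕ))
  | h q => .inl ((2 * n + 2 + q : ℕ))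
  | a i => .inr (.inl i)
  | b₀ => .inr (.inr (.inl 0))
  | e q => .inr (.inr (.inl q.castSucc.succ))
  | bₖ => .inr (.inr (.inl (Fin.last _)))
  | c q => .inr (.inr (.inr q))

theorem toVertex_surjective : Function.Surjective (toVertex (n := n)) := by
  rintro (j | i | i | q)
  · have hj : j.val < 3 * n + 2 := ZMod.val_lt (n := 3 * n + 2) j
    have hjj : (j.val : ZMod (3 * (n + 1) - 1)) = j := ZMod.natCast_zmod_val (n := 3 * n + 2) j
    rw [← hjj]
    generalize j.val = m at hj
    have : m = 0 ∨ (1 ≤ m ∧ m < n + 1) ∨ (n + 1 ≤ m ∧ m < 2 * n + 1) ∨ m = 2 * n + 1 ∨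
      2 * n + 2 ≤ m := by omega
    rcases this with rfl | h | h | rfl | h
    · exact ⟨z, rfl⟩
    · exact ⟨t ⟨m - 1, by omega⟩, by simp only [toVertex, Nat.sub_add_cancel h.1]⟩
    · exact ⟨l ⟨m - (n + 1), by omega⟩, by simp only [toVertex, Nat.add_sub_cancel' h.1]⟩
    · exact ⟨w, rfl⟩
    · exact ⟨GMCoord.h ⟨m - (2 * n + 2), by omega⟩, by
        simp only [toVertex, Nat.add_sub_cancel' h]⟩
  · exact ⟨a i, rfl⟩
  · induction i using Fin.cases with
    | zero => exact ⟨b₀, rfl⟩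
    | succ i =>
      induction i using Fin.lastCases with
      | last => exact ⟨bₖ, rfl⟩
      | cast q => exact ⟨e q, rfl⟩
  · exact ⟨c q, rfl⟩

theorem toVertex_bijective : Function.Bijective (toVertex (n := n)) := by
  have : NeZero (3 * (n + 1) - 1) := ⟨by omega⟩
  refine (Fintype.bijective_iff_surjective_and_card _).2 ⟨toVertex_surjective, ?_⟩
  rw [card_eq]
  simp only [Fintype.card_sum, Fintype.card_fin, ZMod.card]
  omega

/-- The graph `G` in coordinates. -/
def graph (n : ℕ) : SimpleGraph (GMCoord n) := (gmGraph (n + 1)).comap toVertex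

/-- The coordinates identify `graph n` with `G`. -/
noncomputable def iso (n : ℕ) : graph n ≃g gmGraph (n + 1) :=
  Iso.comap (Equiv.ofBijective toVertex toVertex_bijective) _

theorem graph_adj {u v : GMCoord n} : (graph n).Adj u v ↔
    u ≠ v ∧ (gmRel (n + 1) (toVertex u) (toVertex v) ∨ gmRel (n + 1) (toVertex v) (toVertex u)) := by
  rw [graph, comap_adj, gmGraph, fromRel_adj, toVertex_bijective.1.ne_iff]

theorem cast_inj {x y : ℕ} (hx : x < 3 * n + 2) (hy : y < 3 * n + 2) :
    (x : ZMod (3 * (n + 1) - 1)) = y ↔ x = y := by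
  constructor
  · intro h
    have := (ZMod.natCast_eq_natCast_iff' x y _).1 h
    have hm : 3 * (n + 1) - 1 = 3 * n + 2 := by omega
    rwa [hm, Nat.mod_eq_of_lt hx, Nat.mod_eq_of_lt hy] at this
  · rintro rfl
    rfl

theorem gmRel_of_add {i j d : ℕ} (h : i + d = j) (h₁ : n + 1 ≤ d) (h₂ : d ≤ 2 * n + 1) :
    gmRel (n + 1) (.inl (i : ZMod (3 * (n + 1) - 1))) (.inl (j : ZMod (3 * (n + 1) - 1))) :=
  ⟨d, h₁, by omega, by rw [← h, Nat.cast_add]⟩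

theorem adj_of_edge {u v : GMCoord n} (huv : Edge u v) : (graph n).Adj u v := by
  rw [graph_adj]
  refine ⟨by rintro rfl; cases u <;> exact huv, ?_⟩
  cases u <;> cases v <;> try exact huv.elim
  case z.w => exact Or.inl (gmRel_of_add (zero_add _) (by omega) (by omega))
  case z.l q => exact Or.inl (gmRel_of_add (zero_add _) (by omega) (by omega))
  case b₀.z => exact Or.inl (Or.inr (Or.inr (Or.inr ⟨rfl, Nat.cast_zero⟩)))
  case b₀.t q => exact Or.inl (Or.inl ⟨Nat.succ_pos _, q + 1, by omega, by omega, rfl⟩)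
  case bₖ.w =>
    exact Or.inl (Or.inr (Or.inr (Or.inl ⟨by simp, by congr 1; simp; omega⟩)))
  case bₖ.h q =>
    exact Or.inl (Or.inr (Or.inl ⟨by simp, 2 * n + 2 + q, by omega, by omega, rfl⟩))
  case e.t q s =>
    exact Or.inl (Or.inl ⟨by simp, s + 1, by omega, by omega, rfl⟩)
  case e.l q s =>
    obtain rfl : q = s := huv
    exact Or.inl (Or.inr (Or.inr (Or.inl ⟨by simp, rfl⟩)))
  case t.w q => exact Or.inl (gmRel_of_add (d := 2 * n - q) (by omega) (by omega) (by omega))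
  case t.l q s =>
    have : (q : ℕ) < s := huv
    exact Or.inl (gmRel_of_add (d := n + s - q) (by omega) (by omega) (by omega))
  case t.h q s =>
    have : (s : ℕ) ≤ q := huv
    exact Or.inl (gmRel_of_add (d := 2 * n + 1 + s - q) (by omega) (by omega) (by omega))
  case l.h q s =>
    have : (q : ℕ) ≤ s := huv
    exact Or.inl (gmRel_of_add (d := n + 1 + s - q) (by omega) (by omega) (by omega))

/-- The vertices `b_0, …, b_k`. -/
def b (j : Fin (n + 2)) : GMCoord n :=
  Fin.cases b₀ (fun j => Fin.lastCases bₖ (fun q => e q) j) j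

theorem b_zero : b (0 : Fin (n + 2)) = b₀ := rfl

theorem b_last : b (Fin.last (n + 1)) = bₖ := by
  rw [← Fin.succ_last, b, Fin.cases_succ, Fin.lastCases_last]

theorem b_succ (q : Fin n) : b q.castSucc.succ = e q := by
  rw [b, Fin.cases_succ, Fin.lastCases_castSucc]

theorem toVertex_b (j : Fin (n + 2)) : toVertex (b j) = .inr (.inr (.inl j)) := by
  induction j using Fin.cases with
  | zero => rfl
  | succ i =>
    induction i using Fin.lastCases with
    | last => rw [Fin.succ_last, b_last]; rfl
    | cast q => rw [b_succ]; rfl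

theorem sum_b (f : GMCoord n → ℕ) : ∑ j, f (b j) = f b₀ + f bₖ + ∑ q, f (e q) := by
  rw [Fin.sum_univ_succ, Fin.sum_univ_castSucc, Fin.succ_last, b_last, b_zero]
  simp only [b_succ]
  ring

theorem adj_a_a {i j : Fin (n + 2)} (hij : i ≠ j) : (graph n).Adj (a i) (a j) :=
  graph_adj.2 ⟨by simpa using hij, Or.inl trivial⟩

theorem adj_a_b {i j : Fin (n + 2)} : (graph n).Adj (a i) (b j) ↔ i ≠ j := by
  rw [graph_adj, toVertex_b]
  have : a i ≠ b j := fun h => by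
    have := congrArg toVertex h
    rw [toVertex_b] at this
    simp [toVertex] at this
  simp [this, toVertex, gmRel, Fin.ext_iff]

theorem eq_of_adj_a {i : Fin (n + 2)} {v : GMCoord n} (hv : (graph n).Adj (a i) v) :
    (∃ j, v = a j) ∨ ∃ j, v = b j := by
  replace hv := (graph_adj.1 hv).2
  cases v <;> try (simp [toVertex, gmRel] at hv; done)
  case b₀ => exact Or.inr ⟨0, rfl⟩
  case bₖ => exact Or.inr ⟨_, b_last.symm⟩
  case e q => exact Or.inr ⟨_, (b_succ q).symm⟩
  case a j => exact Or.inl ⟨_, rfl⟩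

/-- The vertices `z`, `w`, `l`, `h`, that is, the neighbors of the vertices `c`. -/
def IsR (v : GMCoord n) : Prop := v = z ∨ v = w ∨ (∃ s, v = l s) ∨ ∃ s, v = h s

theorem adj_c_iff {q : Fin n} {v : GMCoord n} : (graph n).Adj (c q) v ↔ IsR v := by
  constructor
  · intro hv
    replace hv := (graph_adj.1 hv).2
    cases v <;> try (simp [toVertex, gmRel] at hv; done)
    case z => exact Or.inl rfl
    case w => exact Or.inr (Or.inl rfl)
    case l s => exact Or.inr (Or.inr (Or.inl ⟨s, rfl⟩))
    case h s => exact Or.inr (Or.inr (Or.inr ⟨s, rfl⟩))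
    case t s =>
      rcases hv with (hv | ⟨m, hm, hm', hv⟩) | hv
      · have := (cast_inj (n := n) (x := s + 1) (y := 0) (by omega) (by omega)).1
          (by simpa using hv)
        omega
      · have := (cast_inj (n := n) (by omega) (by omega)).1 hv
        omega
      · exact hv.elim
  · rintro (rfl | rfl | ⟨s, rfl⟩ | ⟨s, rfl⟩) <;>
      refine graph_adj.2 ⟨by simp, Or.inl ?_⟩
    · exact Or.inl Nat.cast_zero
    · exact Or.inr ⟨2 * n + 1, by omega, by omega, rfl⟩
    · exact Or.inr ⟨n + 1 + s, by omega, by omega, rfl⟩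
    · exact Or.inr ⟨2 * n + 2 + s, by omega, by omega, rfl⟩

theorem eq_of_adj_t {q : Fin n} {v : GMCoord n} (hv : (graph n).Adj (t q) v) :
    v = b₀ ∨ v = bₖ ∨ (∃ s, v = e s) ∨ v = z ∨ v = w ∨ (∃ s, v = l s) ∨ (∃ s, v = h s) ∨
      ∃ s, v = t s := by
  cases v <;> try simp
  case a i =>
    rcases eq_of_adj_a hv.symm with ⟨j, hj⟩ | ⟨j, hj⟩
    · cases hj
    · have := congrArg toVertex hj
      rw [toVertex_b] at this
      cases this
  case c s => simpa [IsR] using adj_c_iff.1 hv.symm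

theorem exists_ne_of_two_le_sum {m : ℕ} {f : Fin m → ℕ} (hf : ∀ i, f i ≤ 1)
    (h : 2 ≤ ∑ i, f i) : ∃ i j, i ≠ j ∧ f i = 1 ∧ f j = 1 := by
  by_contra hc
  push Not at hc
  obtain ⟨i, hi⟩ : ∃ i, f i = 1 := by
    by_contra h0
    push Not at h0
    have : ∑ i, f i = 0 := Finset.sum_eq_zero fun i _ => by have := hf i; have := h0 i; omega
    omega
  have h1 : ∑ j, f j ≤ ∑ j, if j = i then 1 else 0 := Finset.sum_le_sum fun j _ => by
    have := hf j
    split_ifs with hj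
    · exact this
    · have := hc i j (Ne.symm hj) hi; omega
  simp only [Finset.sum_ite_eq', Finset.mem_univ, if_true] at h1
  omega

theorem exists_one_of_sum_pos {m : ℕ} {f : Fin m → ℕ} (hf : ∀ i, f i ≤ 1)
    (h : 1 ≤ ∑ i, f i) : ∃ i, f i = 1 := by
  by_contra h0
  push Not at h0
  have : ∑ i, f i = 0 := Finset.sum_eq_zero fun i _ => by have := hf i; have := h0 i; omega
  omega

theorem exists_ne_ne_of_three_le_sum {m : ℕ} {f : Fin m → ℕ} (hf : ∀ i, f i ≤ 1)
    (h : 3 ≤ ∑ i, f i) : ∃ i j k, i ≠ j ∧ k ≠ i ∧ k ≠ j ∧ f i = 1 ∧ f j = 1 ∧ f k = 1 := by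
  obtain ⟨i, j, hij, hi, hj⟩ := exists_ne_of_two_le_sum hf (by omega)
  by_contra hc
  push Not at hc
  have h1 : ∑ k, f k ≤ ∑ k, ((if k = i then 1 else 0) + if k = j then 1 else 0) :=
    Finset.sum_le_sum fun k _ => by
      have := hf k
      by_cases hki : k = i
      · simp only [hki, if_true]; omega
      · by_cases hkj : k = j
        · simp only [hkj, if_true]; omega
        · have := hc i j k hij hki hkj hi hj; omega
  simp only [Finset.sum_add_distrib, Finset.sum_ite_eq', Finset.mem_univ, if_true] at h1
  omega

/-- Zero-one indicator of a set of vertices. -/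
def ind (U : Finset (GMCoord n)) (v : GMCoord n) : ℕ := if v ∈ U then 1 else 0

theorem ind_le (U : Finset (GMCoord n)) (v : GMCoord n) : ind U v ≤ 1 := by
  unfold ind; split_ifs <;> simp

theorem ind_eq_one {U : Finset (GMCoord n)} {v : GMCoord n} : ind U v = 1 ↔ v ∈ U := by
  simp [ind]

theorem ind_eq_zero {U : Finset (GMCoord n)} {v : GMCoord n} : ind U v = 0 ↔ v ∉ U := by
  simp [ind]

theorem sum_ind (U : Finset (GMCoord n)) : ∑ v, ind U v = U.card := by
  simp [ind]

/-- A zero forcing set misses at most two vertices of the clique. -/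
theorem sum_compl_a_le {S : Finset (GMCoord n)} (hS : IsZeroForcingSet (graph n) (S : Set _)) :
    ∑ i, ind Sᶜ (a i) ≤ 2 := by
  by_contra hc
  obtain ⟨i, j, k, hij, hki, hkj, hi, hj, hk⟩ :=
    exists_ne_ne_of_three_le_sum (fun i => ind_le Sᶜ (a i)) (by omega)
  simp only [ind_eq_one, Finset.mem_compl] at hi hj hk
  have hF : ∀ u ∉ ({a i, a j, a k} : Set (GMCoord n)), ∀ v ∈ ({a i, a j, a k} : Set (GMCoord n)),
      (graph n).Adj u v → ∃ x ∈ ({a i, a j, a k} : Set (GMCoord n)), x ≠ v ∧ (graph n).Adj u x := by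
    intro u hu v hv huv
    have huv' : (∃ m, u = a m) ∨ ∃ m, u = b m := by
      rcases hv with rfl | rfl | rfl <;> exact eq_of_adj_a huv.symm
    have key : ∀ p q : Fin (n + 2), p ≠ q → u ≠ a p → u ≠ a q →
        (graph n).Adj u (a p) ∨ (graph n).Adj u (a q) := by
      intro p q hpq hup huq
      rcases huv' with ⟨m, rfl⟩ | ⟨m, rfl⟩
      · exact Or.inl (adj_a_a fun h => hup (by rw [h]))
      · by_cases hpm : p = m
        · exact Or.inr (adj_a_b.2 (hpm ▸ hpq.symm)).symm
        · exact Or.inl (adj_a_b.2 hpm).symm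
    simp only [Set.mem_insert_iff, Set.mem_singleton_iff, not_or] at hu
    rcases hv with rfl | rfl | rfl
    · rcases key j k hkj.symm hu.2.1 hu.2.2 with h | h
      · exact ⟨_, by simp, by simpa using hij.symm, h⟩
      · exact ⟨_, by simp, by simpa using hki, h⟩
    · rcases key i k hki.symm hu.1 hu.2.2 with h | h
      · exact ⟨_, by simp, by simpa using hij, h⟩
      · exact ⟨_, by simp, by simpa using hkj, h⟩
    · rcases key i j hij hu.1 hu.2.1 with h | h
      · exact ⟨_, by simp, by simpa using hki.symm, h⟩
      · exact ⟨_, by simp, by simpa using hkj.symm, h⟩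
  obtain ⟨x, hx, hxS⟩ := hS.exists_mem_fort ⟨a i, by simp⟩ hF
  rcases hx with rfl | rfl | rfl
  · exact hi hxS
  · exact hj hxS
  · exact hk hxS

/-- A zero forcing set misses at most one vertex `c`. -/
theorem sum_compl_c_le {S : Finset (GMCoord n)} (hS : IsZeroForcingSet (graph n) (S : Set _)) :
    ∑ q, ind Sᶜ (c q) ≤ 1 := by
  by_contra hc
  obtain ⟨i, j, hij, hi, hj⟩ := exists_ne_of_two_le_sum (fun i => ind_le Sᶜ (c i)) (by omega)
  simp only [ind_eq_one, Finset.mem_compl] at hi hj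
  have hF : ∀ u ∉ ({c i, c j} : Set (GMCoord n)), ∀ v ∈ ({c i, c j} : Set (GMCoord n)),
      (graph n).Adj u v → ∃ x ∈ ({c i, c j} : Set (GMCoord n)), x ≠ v ∧ (graph n).Adj u x := by
    intro u _ v hv huv
    rcases hv with rfl | rfl
    · exact ⟨c j, by simp, by simpa using hij.symm, (adj_c_iff.2 (adj_c_iff.1 huv.symm)).symm⟩
    · exact ⟨c i, by simp, by simpa using hij, (adj_c_iff.2 (adj_c_iff.1 huv.symm)).symm⟩
  obtain ⟨x, hx, hxS⟩ := hS.exists_mem_fort ⟨c i, by simp⟩ hF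
  rcases hx with rfl | rfl
  · exact hi hxS
  · exact hj hxS

section State

variable {S U B : Finset (GMCoord n)}

theorem blue_of_a (h : ForcingState (graph n) S U B) {i : Fin (n + 2)} (hi : a i ∈ U) :
    (∀ j, ind Bᶜ (a j) = 0) ∧ ∀ j, i ≠ j → ind Bᶜ (b j) = 0 := by
  simp only [ind_eq_zero, Finset.mem_compl, not_not]
  refine ⟨fun j => ?_, fun j hj => h.mem_of_adj hi (adj_a_b.2 hj)⟩
  by_cases hj : i = j
  · exact hj ▸ h.subset hi
  · exact h.mem_of_adj hi (adj_a_a hj)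

theorem blue_of_c (h : ForcingState (graph n) S U B) {q : Fin n} (hq : c q ∈ U) {v : GMCoord n}
    (hv : IsR v) : v ∈ B := h.mem_of_adj hq (adj_c_iff.2 hv)

theorem sum_a_le (h : ForcingState (graph n) S U B) : ∑ i, ind U (a i) ≤ 2 := by
  induction h with
  | start => simp [ind]
  | @step U B u v h hf ih =>
    by_cases hu : ∃ i, u = a i
    · obtain ⟨i, rfl⟩ := hu
      by_cases h2 : 2 ≤ ∑ i, ind U (a i)
      · exfalso
        obtain ⟨j, k, hjk, hj, hk⟩ := exists_ne_of_two_le_sum (fun i => ind_le U (a i)) h2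
        obtain ⟨hj₁, hj₂⟩ := blue_of_a h (ind_eq_one.1 hj)
        obtain ⟨hk₁, hk₂⟩ := blue_of_a h (ind_eq_one.1 hk)
        simp only [ind_eq_zero, Finset.mem_compl, not_not] at hj₁ hj₂ hk₁ hk₂
        refine hf.2.1 ?_
        rcases eq_of_adj_a hf.2.2.1 with ⟨m, rfl⟩ | ⟨m, rfl⟩
        · exact hj₁ m
        · by_cases hm : j = m
          · exact hk₂ m (hm ▸ hjk.symm)
          · exact hj₂ m hm
      · have : ∑ j, ind (insert (a i) U) (a j) ≤ ∑ j, (ind U (a j) + if j = i then 1 else 0) :=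
          Finset.sum_le_sum fun j _ => by
            by_cases hj : j = i <;> simp [ind, hj]
        simp only [Finset.sum_add_distrib, Finset.sum_ite_eq', Finset.mem_univ, if_true] at this
        omega
    · push Not at hu
      simpa [ind, fun j => (hu j).symm] using ih

theorem sum_c_le (h : ForcingState (graph n) S U B) : ∑ i, ind U (c i) ≤ 1 := by
  induction h with
  | start => simp [ind]
  | @step U B u v h hf ih =>
    by_cases hu : ∃ i, u = c i
    · obtain ⟨i, rfl⟩ := hu
      by_cases h2 : 1 ≤ ∑ i, ind U (c i)
      · exfalso
        obtain ⟨j, hj⟩ := exists_one_of_sum_pos (fun i => ind_le U (c i)) h2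
        exact hf.2.1 (blue_of_c h (ind_eq_one.1 hj) (adj_c_iff.1 hf.2.2.1))
      · have : ∑ j, ind (insert (c i) U) (c j) ≤ ∑ j, (ind U (c j) + if j = i then 1 else 0) :=
          Finset.sum_le_sum fun j _ => by
            by_cases hj : j = i <;> simp [ind, hj]
        simp only [Finset.sum_add_distrib, Finset.sum_ite_eq', Finset.mem_univ, if_true] at this
        omega
    · push Not at hu
      simpa [ind, fun j => (hu j).symm] using ih

theorem c_constraint
    (h : ForcingState (graph n) S U B) (hY : ∑ q, ind Bᶜ (c q) ≤ 1) {v : GMCoord n}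
    (hv : IsR v) :
    ind U v + ∑ q, ind Bᶜ (c q) ≤ 1 ∧ ∑ q, ind U (c q) + ind Bᶜ v ≤ 1 := by
  constructor
  · by_cases hU : v ∈ U
    · have : ∑ q, ind Bᶜ (c q) = 0 := Finset.sum_eq_zero fun q _ => by
        simpa [ind_eq_zero] using h.mem_of_adj hU (adj_c_iff.2 hv).symm
      have := ind_le U v
      omega
    · have := ind_eq_zero.2 hU
      omega
  · have h1 := sum_c_le h
    have h2 := ind_le Bᶜ v
    by_contra hc
    obtain ⟨j, hj⟩ := exists_one_of_sum_pos (fun i => ind_le U (c i)) (by omega)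
    have : ind Bᶜ v = 0 := by
      simpa [ind_eq_zero] using blue_of_c h (ind_eq_one.1 hj) hv
    omega

theorem valid_of_forcingState (hS : IsZeroForcingSet (graph n) (S : Set _))
    (hcard : S.card = 4 * n + 1) (h : ForcingState (graph n) S U B) :
    Valid (ind U) (ind Bᶜ) := by
  have hmono : ∀ v, ind Bᶜ v ≤ ind Sᶜ v := fun v => by
    have := h.base_subset
    by_cases hv : v ∈ S
    · simp [ind, this hv]
    · rw [ind_eq_one.2 (Finset.mem_compl.2 hv : v ∈ Sᶜ)]
      exact ind_le _ _
  have hYa : ∑ i, ind Bᶜ (a i) ≤ 2 :=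
    (Finset.sum_le_sum fun i _ => hmono (a i)).trans (sum_compl_a_le hS)
  have hYc : ∑ i, ind Bᶜ (c i) ≤ 1 :=
    (Finset.sum_le_sum fun i _ => hmono (c i)).trans (sum_compl_c_le hS)
  have hadj : ∀ {u v}, (graph n).Adj u v → ind U u + ind Bᶜ v ≤ 1 := fun {u v} huv => by
    have h1 := ind_le Bᶜ v
    have h2 := ind_le U u
    by_contra hc
    have := h.mem_of_adj (ind_eq_one.1 (by omega : ind U u = 1)) huv
    have : ind Bᶜ v = 0 := by simpa [ind_eq_zero] using this
    omega
  have hb : ∀ j, ind U (b j) = 1 → ∀ i, i ≠ j → ind Bᶜ (a i) = 0 := fun j hj i hij => by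
    have := hadj (adj_a_b.2 hij).symm
    omega
  refine ⟨fun v => ?_, fun u v huv => ?_, ⟨sum_a_le h, hYa⟩, fun ha => ?_, fun hb₁ => ?_,
    fun hb₂ => ?_, ⟨sum_c_le h, hYc⟩, c_constraint h hYc (Or.inl rfl),
    c_constraint h hYc (Or.inr (Or.inl rfl)),
    fun s => c_constraint h hYc (Or.inr (Or.inr (Or.inl ⟨s, rfl⟩))),
    fun s => c_constraint h hYc (Or.inr (Or.inr (Or.inr ⟨s, rfl⟩))), ?_⟩
  · have := h.subset
    by_cases hv : v ∈ U
    · simp [ind, hv, this hv]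
    · rw [ind_eq_zero.2 hv, zero_add]
      exact ind_le _ _
  · exact ⟨hadj (adj_of_edge huv), hadj (adj_of_edge huv).symm⟩
  · obtain ⟨i, hi⟩ := exists_one_of_sum_pos (fun i => ind_le U (a i)) ha
    obtain ⟨hi₁, hi₂⟩ := blue_of_a h (ind_eq_one.1 hi)
    refine ⟨Finset.sum_eq_zero fun j _ => hi₁ j, ?_⟩
    have hsum := sum_b (ind Bᶜ)
    have hX := sum_a_le h
    by_contra hc
    obtain ⟨j, hj⟩ := exists_one_of_sum_pos (fun i => ind_le Bᶜ (b i)) (by omega)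
    by_cases hX1 : 2 ≤ ∑ i, ind U (a i)
    · obtain ⟨p, q, hpq, hp, hq⟩ := exists_ne_of_two_le_sum (fun i => ind_le U (a i)) hX1
      have hp₂ := (blue_of_a h (ind_eq_one.1 hp)).2 j
      have hq₂ := (blue_of_a h (ind_eq_one.1 hq)).2 j
      by_cases hpj : p = j
      · have := hq₂ (hpj ▸ hpq.symm)
        omega
      · have := hp₂ hpj
        omega
    · obtain ⟨p, q, hpq, hp, hq⟩ := exists_ne_of_two_le_sum (fun i => ind_le Bᶜ (b i)) (by omega)
      by_cases hpi : i = p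
      · have := hi₂ q (hpi ▸ hpq)
        omega
      · have := hi₂ p hpi
        omega
  · rw [← sum_b] at hb₁
    obtain ⟨j, hj⟩ := exists_one_of_sum_pos (fun i => ind_le U (b i)) hb₁
    by_contra hc
    obtain ⟨p, q, hpq, hp, hq⟩ := exists_ne_of_two_le_sum (fun i => ind_le Bᶜ (a i)) (by omega)
    by_cases hpj : p = j
    · have := hb j hj q (hpj ▸ hpq.symm)
      omega
    · have := hb j hj p hpj
      omega
  · rw [← sum_b] at hb₂
    obtain ⟨j, k, hjk, hj, hk⟩ := exists_ne_of_two_le_sum (fun i => ind_le U (b i)) hb₂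
    refine Finset.sum_eq_zero fun i _ => ?_
    by_cases hij : i = j
    · exact hb k hk i (hij ▸ hjk)
    · exact hb j hj i hij
  · have h1 := h.card_eq
    have h2 := Finset.card_compl_add_card B
    rw [card_eq] at h2
    have hU := sum_ind U
    have hB := sum_ind Bᶜ
    rw [sum_eq] at hU hB
    simp only [Finset.sum_add_distrib] at hU hB ⊢
    omega

theorem fam_of_forcingState (hn : 1 ≤ n) (hS : IsZeroForcingSet (graph n) (S : Set _))
    (hcard : S.card = 4 * n + 1) (h : ForcingState (graph n) S U B) : Valid.Fam (ind U) := by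
  induction h with
  | start =>
    have h0 : ∀ v : GMCoord n, ind ∅ v = 0 := fun v => by simp [ind]
    exact .ae ⟨h0 _, h0 _, fun _ => h0 _, fun _ => h0 _⟩ (h0 _) (fun _ => h0 _) (fun _ => h0 _)
  | @step U B u v h hf ih =>
    have hs : Valid.Step (ind U) (ind Bᶜ) (ind (insert u U)) (ind (insert v B)ᶜ) u v :=
      { left := valid_of_forcingState hS hcard h
        right := valid_of_forcingState hS hcard (h.step hf)
        u_eq := ind_eq_zero.2 (h.notMem_of_force hf)
        u_eq' := by simp [ind]
        ne := fun x hx => by simp [ind, hx]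
        v_eq := ind_eq_one.2 (by simpa using hf.2.1)
        v_eq' := by simp [ind]
        vu := by rintro rfl; exact hf.2.1 hf.1
        of_c := fun q hq => adj_c_iff.1 (hq ▸ hf.2.2.1)
        of_t := fun q hq => eq_of_adj_t (hq ▸ hf.2.2.1) }
    exact hs.fam hn ih

theorem not_isZeroForcingSet (hn : 1 ≤ n) (hcard : S.card = 4 * n + 1) :
    ¬ IsZeroForcingSet (graph n) (S : Set _) := by
  intro hS
  obtain ⟨U, hU⟩ := hS.exists_forcingState
  exact (valid_of_forcingState hS hcard hU).not_fam (fun v => by simp [ind])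
    (fam_of_forcingState hn hS hcard hU)

end State

theorem of_gmRel_b {i : Fin (n + 2)} {m : ℕ} (hm : m < 3 * n + 2)
    (h : gmRel (n + 1) (.inr (.inr (.inl i))) (.inl (m : ZMod (3 * (n + 1) - 1)))) :
    ((i : ℕ) < n + 1 ∧ 1 ≤ m ∧ m ≤ n) ∨ ((i : ℕ) = n + 1 ∧ 2 * n + 2 ≤ m) ∨
      (1 ≤ (i : ℕ) ∧ m = n + i) ∨ ((i : ℕ) = 0 ∧ m = 0) := by
  rcases h with ⟨hi, x, hx, hx', h⟩ | ⟨hi, x, hx, hx', h⟩ | ⟨hi, h⟩ | ⟨hi, h⟩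
  · have := (cast_inj hm (by omega)).1 h
    omega
  · have := (cast_inj hm (by omega)).1 h
    omega
  · have := (cast_inj hm (by omega)).1 h
    omega
  · have := (cast_inj (y := 0) hm (by omega)).1 (by simpa using h)
    omega

theorem of_gmRel_circulant {i j : ℕ} (hi : i < 3 * n + 2) (hj : j < 3 * n + 2)
    (h : gmRel (n + 1) (.inl (i : ZMod (3 * (n + 1) - 1))) (.inl (j : ZMod (3 * (n + 1) - 1)))) :
    ∃ d, n + 1 ≤ d ∧ d ≤ 2 * n + 1 ∧ (j = i + d ∨ j + (3 * n + 2) = i + d) := by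
  obtain ⟨d, h₁, h₂, h⟩ := h
  refine ⟨d, h₁, by omega, ?_⟩
  rw [← Nat.cast_add] at h
  by_cases hid : i + d < 3 * n + 2
  · exact Or.inl ((cast_inj hj hid).1 h)
  · have hm : ((3 * (n + 1) - 1 : ℕ) : ZMod (3 * (n + 1) - 1)) = 0 := ZMod.natCast_self _
    have h' : (j : ZMod (3 * (n + 1) - 1)) = ((i + d - (3 * (n + 1) - 1) : ℕ) : ZMod _) := by
      rw [h, Nat.cast_sub (by omega), hm, sub_zero]
    have := (cast_inj hj (by omega)).1 h'
    omega

theorem not_adj_z_h (p : Fin n) : ¬ (graph n).Adj z (h p) := by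
  intro hp
  rcases (graph_adj.1 hp).2 with hp | hp
  · obtain ⟨d, hd⟩ := of_gmRel_circulant (by omega) (by omega) hp
    omega
  · obtain ⟨d, hd⟩ := of_gmRel_circulant (by omega) (by omega) hp
    omega

theorem le_of_adj_t_h {q p : Fin n} (hp : (graph n).Adj (t q) (h p)) : p ≤ q := by
  rw [Fin.le_def]
  rcases (graph_adj.1 hp).2 with hp | hp
  · obtain ⟨d, hd⟩ := of_gmRel_circulant (by omega) (by omega) hp
    omega
  · obtain ⟨d, hd⟩ := of_gmRel_circulant (by omega) (by omega) hp
    omega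

theorem eq_of_adj_b₀ {v : GMCoord n} (hv : (graph n).Adj b₀ v) (hR : IsR v) : v = z := by
  rcases hR with rfl | rfl | ⟨s, rfl⟩ | ⟨s, rfl⟩
  · rfl
  all_goals
    rcases (graph_adj.1 hv).2 with hv | hv
    · have := of_gmRel_b (by omega) hv
      simp only [Fin.val_zero] at this
      omega
    · exact hv.elim

theorem eq_of_adj_e {q : Fin n} {v : GMCoord n} (hv : (graph n).Adj (e q) v) (hR : IsR v) :
    v = l q := by
  rcases hR with rfl | rfl | ⟨s, rfl⟩ | ⟨s, rfl⟩
  case inr.inr.inl =>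
    rcases (graph_adj.1 hv).2 with hv | hv
    · have := of_gmRel_b (by omega) hv
      simp only [Fin.val_succ, Fin.val_castSucc] at this
      congr 1
      ext
      omega
    · exact hv.elim
  all_goals
    rcases (graph_adj.1 hv).2 with hv | hv
    · have := of_gmRel_b (by omega) hv
      simp only [Fin.val_succ, Fin.val_castSucc] at this
      omega
    · exact hv.elim

/-- The vertices outside a minimum zero forcing set. -/
def white : GMCoord n → Bool
  | z | w | b₀ | l _ | h _ => true
  | a i => i = 1
  | _ => false

/-- A zero forcing set of `4k - 2` vertices. -/
def blues (n : ℕ) : Finset (GMCoord n) := Finset.univ.filter fun v => white v = false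

theorem card_blues : (blues n).card = 4 * n + 2 := by
  have h : ∑ i : Fin (n + 2), (if i = 1 then 0 else 1) = n + 1 := by
    have := Finset.sum_ite_eq' (Finset.univ : Finset (Fin (n + 2))) 1 (fun _ => 1)
    have h2 : ∑ i : Fin (n + 2), ((if i = 1 then 0 else 1) + (if i = 1 then 1 else 0)) = n + 2 := by
      rw [Finset.sum_congr rfl (g := fun _ => 1) fun i _ => by split_ifs <;> rfl]
      simp
    rw [Finset.sum_add_distrib, this] at h2
    simpa using h2
  rw [blues, Finset.card_filter, sum_eq]
  simp only [white, Bool.true_eq_false, if_true, if_false, decide_eq_false_iff_not, ite_not, h,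
    Finset.sum_add_distrib, Finset.sum_const, Finset.card_univ, Fintype.card_fin, smul_eq_mul]
  omega

theorem isZeroForcingSet_blues : IsZeroForcingSet (graph n) (blues n : Set (GMCoord n)) := by
  intro B hB hc
  have blue : ∀ v, white v = false → v ∈ B := fun v hv => hB (by simpa [blues] using hv)
  have force : ∀ u v, u ∈ B → (graph n).Adj u v →
      (∀ x, (graph n).Adj u x → white x = true → x ∉ B → x = v) → v ∈ B := fun u v hu huv hx => by
    by_contra hv
    exact hv (hc u v ⟨hu, hv, huv, fun x hux hxB => hx x hux
      (by by_contra hw; exact hxB (blue x (by simpa using hw))) hxB⟩)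
  have h01 : (0 : Fin (n + 2)) ≠ 1 := Fin.zero_ne_one
  have eq_of_white : ∀ {x : GMCoord n}, white x = true → x = a 1 ∨ x = b₀ ∨ IsR x := by
    intro x hx
    cases x <;> simp_all [white, IsR]
  have a_one : a 1 ∈ B := by
    refine force (a 0) _ (blue _ (by simp [white])) (adj_a_a h01) fun x hx hw _ => ?_
    rcases eq_of_adj_a hx with ⟨j, rfl⟩ | ⟨j, rfl⟩
    · simpa [white] using hw
    · induction j using Fin.cases with
      | zero => exact (adj_a_b.1 hx rfl).elim
      | succ j =>
        induction j using Fin.lastCases with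
        | last => rw [Fin.succ_last, b_last] at hw; cases hw
        | cast q => rw [b_succ] at hw; cases hw
  have b_zero_mem : b₀ ∈ B := by
    refine force (a 1) _ a_one (b_zero (n := n) ▸ adj_a_b.2 h01.symm) fun x hx hw hB => ?_
    rcases eq_of_white hw with rfl | rfl | hR
    · exact (hB a_one).elim
    · rfl
    · rcases eq_of_adj_a hx with ⟨j, rfl⟩ | ⟨j, rfl⟩
      · simp [IsR] at hR
      · rcases hR with h | h | ⟨s, h⟩ | ⟨s, h⟩ <;>
          · have := congrArg toVertex h
            rw [toVertex_b] at this
            cases this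
  have isR : ∀ {x : GMCoord n}, white x = true → x ∉ B → IsR x := fun hw hB => by
    rcases eq_of_white hw with rfl | rfl | hR
    · exact (hB a_one).elim
    · exact (hB b_zero_mem).elim
    · exact hR
  have z_mem : z ∈ B := force b₀ _ b_zero_mem (adj_of_edge trivial) fun x hx hw hB =>
    eq_of_adj_b₀ hx (isR hw hB)
  have l_mem : ∀ q, l q ∈ B := fun q => force (e q) _ (blue _ rfl) (adj_of_edge rfl)
    fun x hx hw hB => eq_of_adj_e hx (isR hw hB)
  have w_mem : w ∈ B := force z _ z_mem (adj_of_edge trivial) fun x hx hw hB => by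
    rcases isR hw hB with rfl | rfl | ⟨s, rfl⟩ | ⟨s, rfl⟩
    · exact (hB z_mem).elim
    · rfl
    · exact (hB (l_mem s)).elim
    · exact (not_adj_z_h s hx).elim
  have h_mem : ∀ q, h q ∈ B := fun q => by
    induction q using WellFoundedLT.induction with
    | ind q ih =>
      refine force (t q) _ (blue _ rfl) (adj_of_edge (le_refl (q : ℕ))) fun x hx hw hB => ?_
      rcases isR hw hB with rfl | rfl | ⟨s, rfl⟩ | ⟨s, rfl⟩
      · exact (hB z_mem).elim
      · exact (hB w_mem).elim
      · exact (hB (l_mem s)).elim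
      · rcases (le_of_adj_t_h hx).lt_or_eq with hs | rfl
        · exact (hB (ih s hs)).elim
        · rfl
  refine Set.eq_univ_of_forall fun x => ?_
  by_contra hx
  by_cases hw : white x = true
  · rcases isR hw hx with rfl | rfl | ⟨s, rfl⟩ | ⟨s, rfl⟩
    exacts [hx z_mem, hx w_mem, hx (l_mem s), hx (h_mem s)]
  · exact hx (blue x (by simpa using hw))

end GMCoord

/-- For `k ≥ 2`, the graph `G` of the construction satisfies `Z(G) = 4k - 2`;
in particular no set of `4k - 3` vertices is a zero forcing set of `G`. -/
theorem zfNum_gmGraph_eq (k : ℕ) (hk : 2 ≤ k) [NeZero (3 * k - 1)] :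
    zfNum (gmGraph k) = 4 * k - 2 ∧
    ∀ S : Finset (GMVertex k), S.card = 4 * k - 3 →
      ¬ IsZeroForcingSet (gmGraph k) ↑S := by
  obtain ⟨n, rfl⟩ : ∃ n, k = n + 1 := ⟨k - 1, by omega⟩
  have lower : ∀ S : Finset (GMVertex (n + 1)), S.card = 4 * (n + 1) - 3 →
      ¬ IsZeroForcingSet (gmGraph (n + 1)) (S : Set (GMVertex (n + 1))) := by
    intro S hS hZ
    refine GMCoord.not_isZeroForcingSet (n := n)
      (S := S.map (GMCoord.iso n).symm.toEquiv.toEmbedding) (by omega)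
      (by rw [Finset.card_map, hS]; omega) ?_
    refine (hZ.preimage (GMCoord.iso n)).mono fun x hx => ?_
    exact Finset.mem_coe.2 (Finset.mem_map.2 ⟨_, hx, (GMCoord.iso n).symm_apply_apply x⟩)
  refine ⟨le_antisymm (Nat.sInf_le ?_) (le_csInf ⟨_, Finset.univ, ?_, rfl⟩ ?_), lower⟩
  · refine ⟨(GMCoord.blues n).map (GMCoord.iso n).toEquiv.toEmbedding, ?_,
      by rw [Finset.card_map, GMCoord.card_blues]; omega⟩
    refine (GMCoord.isZeroForcingSet_blues.preimage (GMCoord.iso n).symm).mono fun x hx => ?_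
    exact Finset.mem_coe.2 (Finset.mem_map.2 ⟨_, hx, (GMCoord.iso n).apply_symm_apply x⟩)
  · intro B hB _
    exact Set.eq_univ_of_forall fun x => hB (by simp)
  · rintro m ⟨S, hS, rfl⟩
    by_contra hlt
    have hcard : Fintype.card (GMVertex (n + 1)) = 6 * n + 6 :=
      (Fintype.card_congr (GMCoord.iso n).toEquiv).symm.trans GMCoord.card_eq
    obtain ⟨T, hST, hT⟩ := Finset.exists_superset_card_eq (s := S) (n := 4 * (n + 1) - 3)
      (by omega) (by omega)
    exact lower T hT (hS.mono (Finset.coe_subset.2 hST))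
end

section
/- For every integer k ≥ 2, there exists a pair of non-isomorphic 2k-regular graphs that are cospectral with respect to the adjacency matrix and have different zero forcing numbers. -/
open SimpleGraph Matrix
open scoped Classical


namespace ZeroForcing

section General

variable {V W : Type*}

/-- A nonempty set `F` such that no vertex outside `F` has exactly one neighbor in `F`. -/
def IsFort (G : SimpleGraph V) (F : Set V) : Prop :=
  F.Nonempty ∧ ∀ u ∉ F, ∀ v ∈ F, G.Adj u v → ∃ v' ∈ F, v' ≠ v ∧ G.Adj u v'

lemma IsFort.inter_nonempty {G : SimpleGraph V} {F S : Set V} (hF : IsFort G F)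
    (hS : IsZeroForcingSet G S) : (F ∩ S).Nonempty := by
  by_contra h
  have hSF : S ⊆ Fᶜ := fun v hv hvF => h ⟨v, hvF, hv⟩
  have hclosed : ZFClosed G Fᶜ := by
    rintro u v ⟨hu, hv, huv, huniq⟩
    obtain ⟨v', hv', hne, hadj⟩ := hF.2 u hu v (not_not.mp hv) huv
    exact absurd (huniq v' hadj (not_not.mpr hv')) hne
  obtain ⟨v, hv⟩ := hF.1
  have : v ∈ Fᶜ := by rw [hS _ hSF hclosed]; trivial
  exact this hv

/-- If `x i` is adjacent to `y i`, and is neither equal nor adjacent to `y j` for `i < j`, then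
the complement of the range of `y` is a zero forcing set. -/
lemma isZeroForcingSet_compl_range {G : SimpleGraph V} {r : ℕ} (x y : Fin r → V)
    (hadj : ∀ i, G.Adj (x i) (y i)) (hlt : ∀ i j, i < j → ¬ G.Adj (x i) (y j) ∧ x i ≠ y j) :
    IsZeroForcingSet G (Set.range y)ᶜ := by
  intro B hSB hB
  have hy : ∀ i, y i ∈ B := by
    intro i
    induction i using WellFoundedLT.induction with
    | ind i ih =>
      by_contra hi
      refine hi (hB (x i) (y i) ⟨?_, hi, hadj i, ?_⟩)
      · by_cases hx : x i ∈ Set.range y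
        · obtain ⟨j, hj⟩ := hx
          rcases lt_trichotomy j i with h | rfl | h
          · exact hj ▸ ih j h
          · exact absurd hj (hadj j).ne'
          · exact absurd hj.symm (hlt i j h).2
        · exact hSB hx
      · intro w hw hwB
        have hwr : w ∈ Set.range y := by
          by_contra h
          exact hwB (hSB h)
        obtain ⟨j, rfl⟩ := hwr
        rcases lt_trichotomy j i with h | rfl | h
        · exact absurd (ih j h) hwB
        · rfl
        · exact absurd hw (hlt i j h).1
  refine Set.eq_univ_of_forall fun v => ?_
  by_cases hv : v ∈ Set.range y
  · obtain ⟨i, rfl⟩ := hv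
    exact hy i
  · exact hSB hv

lemma zfNum_le [Fintype V] {G : SimpleGraph V} {S : Finset V} (hS : IsZeroForcingSet G ↑S) :
    zfNum G ≤ S.card :=
  Nat.sInf_le ⟨S, hS, rfl⟩

lemma exists_card_eq_zfNum [Fintype V] (G : SimpleGraph V) :
    ∃ S : Finset V, IsZeroForcingSet G ↑S ∧ S.card = zfNum G := by
  refine Nat.sInf_mem (s := {n | ∃ S : Finset V, IsZeroForcingSet G ↑S ∧ S.card = n})
    ⟨_, Finset.univ, fun B hB _ => ?_, rfl⟩
  simpa using hB

lemma IsZeroForcingSet.image_iso {G : SimpleGraph V} {H : SimpleGraph W} (e : G ≃g H) {S : Set V}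
    (hS : IsZeroForcingSet G S) : IsZeroForcingSet H (e '' S) := by
  intro B hSB hB
  have h : e ⁻¹' B = Set.univ := by
    refine hS _ (Set.image_subset_iff.mp hSB) ?_
    rintro u v ⟨hu, hv, huv, huniq⟩
    refine hB (e u) (e v) ⟨hu, hv, e.map_adj_iff.mpr huv, fun w hw hwB => ?_⟩
    obtain ⟨w, rfl⟩ := e.surjective w
    exact congrArg e (huniq w (e.map_adj_iff.mp hw) hwB)
  refine Set.eq_univ_of_forall fun w => ?_
  obtain ⟨v, rfl⟩ := e.surjective w
  exact h.ge (Set.mem_univ v)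

lemma zfNum_le_of_iso [Fintype V] [Fintype W] {G : SimpleGraph V} {H : SimpleGraph W}
    (e : G ≃g H) : zfNum H ≤ zfNum G := by
  obtain ⟨S, hS, hcard⟩ := exists_card_eq_zfNum G
  have h := IsZeroForcingSet.image_iso e hS
  rw [← Finset.coe_image] at h
  exact (zfNum_le h).trans (Finset.card_image_le.trans hcard.le)

lemma zfNum_eq_of_iso [Fintype V] [Fintype W] {G : SimpleGraph V} {H : SimpleGraph W}
    (e : G ≃g H) : zfNum G = zfNum H :=
  le_antisymm (zfNum_le_of_iso e.symm) (zfNum_le_of_iso e)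

lemma charpoly_adjMatrix_eq_of_iso [Fintype V] [Fintype W] [DecidableEq V] [DecidableEq W]
    {G : SimpleGraph V} {H : SimpleGraph W} (e : G ≃g H) :
    (G.adjMatrix ℝ).charpoly = (H.adjMatrix ℝ).charpoly := by
  rw [← Matrix.charpoly_reindex e.toEquiv (G.adjMatrix ℝ)]
  congr 1
  ext i j
  simp only [Matrix.reindex_apply, Matrix.submatrix_apply, adjMatrix_apply]
  congr 1
  exact propext e.symm.map_adj_iff

lemma isRegularOfDegree_of_iso [Fintype V] [Fintype W] {G : SimpleGraph V}
    {H : SimpleGraph W} (e : G ≃g H) {d : ℕ} (hG : G.IsRegularOfDegree d) :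
    H.IsRegularOfDegree d := by
  intro w
  obtain ⟨v, rfl⟩ := e.surjective w
  rw [e.degree_eq]
  convert hG v

end General

/-- The vertices `inl q` form one copy of `Fin 10`; the classes `5` and `8` get `m` further
members each. -/
def cls {m : ℕ} : Fin 10 ⊕ Fin 2 × Fin m → Fin 10
  | .inl q => q
  | .inr (i, _) => ![5, 8] i

@[simp] lemma cls_inl {m : ℕ} (q : Fin 10) : cls (m := m) (.inl q) = q := rfl

@[simp] lemma cls_inr {m : ℕ} (i : Fin 2) (j : Fin m) : cls (.inr (i, j)) = ![5, 8] i := rfl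

/-- The graph in which distinct vertices are adjacent when `M` has the entry `1` at their
classes. -/
def blowUp (M : Matrix (Fin 10) (Fin 10) ℤ) (hM : M.IsSymm) (m : ℕ) :
    SimpleGraph (Fin 10 ⊕ Fin 2 × Fin m) where
  Adj u v := u ≠ v ∧ M (cls u) (cls v) = 1
  symm := ⟨fun u v h => ⟨h.1.symm, hM.apply (cls u) (cls v) ▸ h.2⟩⟩
  loopless := ⟨fun _ h => h.1 rfl⟩

lemma blowUp_adj {M : Matrix (Fin 10) (Fin 10) ℤ} {hM : M.IsSymm} {m : ℕ}
    {u v : Fin 10 ⊕ Fin 2 × Fin m} :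
    (blowUp M hM m).Adj u v ↔ u ≠ v ∧ M (cls u) (cls v) = 1 :=
  Iff.rfl

/-- Closed adjacency matrix of a `4`-regular graph on ten vertices. -/
def M₁ : Matrix (Fin 10) (Fin 10) ℤ :=
  !![1, 1, 0, 0, 1, 1, 0, 1, 0, 0;
     1, 1, 0, 0, 1, 0, 0, 0, 1, 1;
     0, 0, 1, 1, 0, 1, 1, 0, 0, 1;
     0, 0, 1, 1, 0, 0, 1, 1, 1, 0;
     1, 1, 0, 0, 1, 1, 0, 0, 0, 1;
     1, 0, 1, 0, 1, 1, 1, 0, 0, 0;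
     0, 0, 1, 1, 0, 1, 1, 1, 0, 0;
     1, 0, 0, 1, 0, 0, 1, 1, 1, 0;
     0, 1, 0, 1, 0, 0, 0, 1, 1, 1;
     0, 1, 1, 0, 1, 0, 0, 0, 1, 1]

/-- The matrix obtained from `M₁` by Godsil-McKay switching with respect to `{0, 1, 2, 3}`. -/
def M₂ : Matrix (Fin 10) (Fin 10) ℤ :=
  !![1, 1, 0, 0, 0, 0, 1, 0, 1, 1;
     1, 1, 0, 0, 0, 1, 1, 1, 0, 0;
     0, 0, 1, 1, 1, 0, 0, 1, 1, 0;
     0, 0, 1, 1, 1, 1, 0, 0, 0, 1;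
     0, 0, 1, 1, 1, 1, 0, 0, 0, 1;
     0, 1, 0, 1, 1, 1, 1, 0, 0, 0;
     1, 1, 0, 0, 0, 1, 1, 1, 0, 0;
     0, 1, 1, 0, 0, 0, 1, 1, 1, 0;
     1, 0, 1, 0, 0, 0, 0, 1, 1, 1;
     1, 0, 0, 1, 1, 0, 0, 0, 1, 1]

lemma M₁_isSymm : M₁.IsSymm := by unfold Matrix.IsSymm; decide +kernel

lemma M₂_isSymm : M₂.IsSymm := by unfold Matrix.IsSymm; decide +kernel

lemma M₁_eq_one_of_ne_zero : ∀ p q, M₁ p q ≠ 0 → M₁ p q = 1 :=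
  (by decide +kernel : ∀ p q, Matrix.of.symm M₁ p q ≠ 0 → Matrix.of.symm M₁ p q = 1)

lemma M₂_eq_one_of_ne_zero : ∀ p q, M₂ p q ≠ 0 → M₂ p q = 1 :=
  (by decide +kernel : ∀ p q, Matrix.of.symm M₂ p q ≠ 0 → Matrix.of.symm M₂ p q = 1)

lemma isRegularOfDegree_blowUp {M : Matrix (Fin 10) (Fin 10) ℤ} (hM : M.IsSymm) (m : ℕ)
    (h01 : ∀ p q, M p q ≠ 0 → M p q = 1) (hdiag : ∀ p, M p p = 1) (hrow : ∀ p, ∑ q, M p q = 5)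
    (hext : ∀ p, M p 5 + M p 8 = 1) : (blowUp M hM m).IsRegularOfDegree (m + 4) := by
  intro u
  have key : ((blowUp M hM m).degree u : ℤ) =
      ∑ v : Fin 10 ⊕ Fin 2 × Fin m, M (cls u) (cls v) - 1 := by
    have h1 : ∀ v, M (cls u) (cls v) =
        (if (blowUp M hM m).Adj u v then 1 else 0) + if v = u then 1 else 0 := by
      intro v
      by_cases huv : v = u
      · subst huv
        simp [hdiag]
      · rcases or_iff_not_imp_left.mpr (h01 (cls u) (cls v)) with h | h <;>
          simp [blowUp_adj, huv, h, Ne.symm huv]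
    rw [degree_eq_sum_if_adj (R := ℤ)]
    simp_rw [h1, Finset.sum_add_distrib]
    simp
  have hsum : ∑ v : Fin 10 ⊕ Fin 2 × Fin m, M (cls u) (cls v) = 5 + m := by
    rw [Fintype.sum_sum_type, Fintype.sum_prod_type]
    have h := hext (cls u)
    simp only [cls_inl, cls_inr, hrow, Fin.sum_univ_two, Finset.sum_const, Finset.card_univ,
      Fintype.card_fin, nsmul_eq_mul, Matrix.cons_val_zero, Matrix.cons_val_one]
    rw [← mul_add, h, mul_one]
  have : ((blowUp M hM m).degree u : ℤ) = ((m + 4 : ℕ) : ℤ) := by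
    rw [key, hsum]; push_cast; ring
  exact_mod_cast this

section Cospectral

/-- Class incidence matrix. -/
noncomputable def incMat (m : ℕ) : Matrix (Fin 10 ⊕ Fin 2 × Fin m) (Fin 10) ℝ :=
  Matrix.of fun v q => if cls v = q then 1 else 0

/-- Twice the deviation of the switching matrix from the identity. -/
def switchDev : Matrix (Fin 10) (Fin 10) ℤ :=
  Matrix.of fun p q => if p < 4 ∧ q < 4 then (if p = q then -3 else 1) else 0

lemma switchDev_sq : switchDev * switchDev + (4 : ℤ) • switchDev = 0 := by decide +kernel

lemma switch_conj : ((2 : ℤ) • 1 + switchDev) * M₁ * ((2 : ℤ) • 1 + switchDev) = (4 : ℤ) • M₂ := by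
  decide +kernel

lemma switchDev_transpose : switchDevᵀ = switchDev := by decide +kernel

lemma incMat_mul (m : ℕ) (S : Matrix (Fin 10) (Fin 10) ℝ) :
    incMat m * S = Matrix.of fun v q => S (cls v) q := by
  ext v q
  simp [Matrix.mul_apply, incMat]

lemma incMat_mul_mul_transpose (m : ℕ) (S : Matrix (Fin 10) (Fin 10) ℝ) :
    incMat m * S * (incMat m)ᵀ = Matrix.of fun u v => S (cls u) (cls v) := by
  rw [incMat_mul]
  ext v q
  simp [Matrix.mul_apply, incMat]

lemma transpose_incMat_mul_incMat_mul (m : ℕ) {S : Matrix (Fin 10) (Fin 10) ℝ}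
    (h5 : ∀ q, S 5 q = 0) (h8 : ∀ q, S 8 q = 0) : (incMat m)ᵀ * (incMat m * S) = S := by
  rw [incMat_mul]
  ext p q
  simp only [Matrix.mul_apply, incMat, Matrix.transpose_apply, Matrix.of_apply, ite_mul, one_mul,
    zero_mul, Fintype.sum_sum_type, Fintype.sum_prod_type, cls_inl, cls_inr, Fin.sum_univ_two,
    Matrix.cons_val_zero, Matrix.cons_val_one, h5, h8, ite_self, Finset.sum_const_zero, add_zero]
  exact (Finset.sum_eq_single p (fun _ _ h => if_neg h) (by simp)).trans (if_pos rfl)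

lemma adjMatrix_blowUp {M : Matrix (Fin 10) (Fin 10) ℤ} (hM : M.IsSymm) (m : ℕ)
    (h01 : ∀ p q, M p q ≠ 0 → M p q = 1) (hdiag : ∀ p, M p p = 1) :
    (blowUp M hM m).adjMatrix ℝ =
      incMat m * M.map (Int.cast : ℤ → ℝ) * (incMat m)ᵀ - 1 := by
  rw [incMat_mul_mul_transpose]
  ext u v
  by_cases huv : u = v
  · subst huv
    simp [hdiag]
  · rcases or_iff_not_imp_left.mpr (h01 (cls u) (cls v)) with h | h <;> simp [blowUp_adj, huv, h]

lemma charpoly_eq_of_mul_eq {n : Type*} [Fintype n] [DecidableEq n] {U A B : Matrix n n ℝ}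
    (hU : U * U = (4 : ℝ) • 1) (h : U * A * U = (4 : ℝ) • B) : A.charpoly = B.charpoly := by
  have h4 : ((1 / 2 : ℝ) • U) * ((1 / 2 : ℝ) • U) = 1 := by
    rw [smul_mul_smul_comm, hU, smul_smul]
    norm_num
  let u : (Matrix n n ℝ)ˣ := ⟨(1 / 2 : ℝ) • U, (1 / 2 : ℝ) • U, h4, h4⟩
  rw [← Matrix.charpoly_units_conj u A, ← Matrix.coe_units_inv]
  congr 1
  change ((1 / 2 : ℝ) • U) * A * ((1 / 2 : ℝ) • U) = B
  rw [smul_mul_assoc, smul_mul_smul_comm, h, smul_smul]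
  norm_num

lemma charpoly_eq_of_switch {n q : Type*} [Fintype n] [DecidableEq n] [Fintype q]
    [DecidableEq q] {E : Matrix n q ℝ} {S R R' : Matrix q q ℝ} (hS : Eᵀ * (E * S) = S)
    (hT : Sᵀ = S) (hSS : S * S + (4 : ℝ) • S = 0)
    (hconj : ((2 : ℝ) • 1 + S) * R * ((2 : ℝ) • 1 + S) = (4 : ℝ) • R') :
    (E * R * Eᵀ - 1).charpoly = (E * R' * Eᵀ - 1).charpoly := by
  have hS' : S * (Eᵀ * E) = S := by
    simpa [Matrix.transpose_mul, hT, Matrix.mul_assoc] using congrArg Matrix.transpose hS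
  let U : Matrix n n ℝ := (2 : ℝ) • 1 + E * S * Eᵀ
  let P : Matrix q q ℝ := (2 : ℝ) • 1 + S
  have hUE : U * E = E * P := by
    simp only [U, P, Matrix.add_mul, Matrix.mul_add, Matrix.mul_assoc, hS', Matrix.smul_mul,
      Matrix.mul_smul, Matrix.one_mul, Matrix.mul_one]
  have hEU : Eᵀ * U = P * Eᵀ := by
    simp only [U, P, Matrix.add_mul, Matrix.mul_add, ← Matrix.mul_assoc, Matrix.smul_mul,
      Matrix.mul_smul, Matrix.one_mul, Matrix.mul_one]
    rw [Matrix.mul_assoc Eᵀ E S, hS]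
  have hUU : U * U = (4 : ℝ) • 1 := by
    have h : E * S * Eᵀ * (E * S * Eᵀ) = -((4 : ℝ) • (E * S * Eᵀ)) := by
      have : E * S * Eᵀ * (E * S * Eᵀ) = E * (S * (Eᵀ * (E * S))) * Eᵀ := by
        simp only [Matrix.mul_assoc]
      rw [this, hS, eq_neg_of_add_eq_zero_left hSS, Matrix.mul_neg, Matrix.neg_mul,
        Matrix.mul_smul, Matrix.smul_mul]
    simp only [U, Matrix.add_mul, Matrix.mul_add, h, Matrix.smul_mul, Matrix.mul_smul,
      Matrix.one_mul, Matrix.mul_one]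
    module
  refine charpoly_eq_of_mul_eq hUU ?_
  have hER : U * (E * R * Eᵀ) * U = (4 : ℝ) • (E * R' * Eᵀ) := by
    calc U * (E * R * Eᵀ) * U = (U * E) * R * (Eᵀ * U) := by simp only [Matrix.mul_assoc]
      _ = E * (P * R * P) * Eᵀ := by rw [hUE, hEU]; simp only [Matrix.mul_assoc]
      _ = (4 : ℝ) • (E * R' * Eᵀ) := by rw [hconj, Matrix.mul_smul, Matrix.smul_mul]
  rw [mul_sub, sub_mul, mul_one, hUU, hER, smul_sub]

lemma charpoly_blowUp_eq (m : ℕ) :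
    ((blowUp M₁ M₁_isSymm m).adjMatrix ℝ).charpoly =
      ((blowUp M₂ M₂_isSymm m).adjMatrix ℝ).charpoly := by
  have hmul : ∀ A B : Matrix (Fin 10) (Fin 10) ℤ, (A * B).map (Int.cast : ℤ → ℝ) =
      A.map Int.cast * B.map Int.cast := fun A B => Matrix.map_mul (f := Int.castRingHom ℝ)
  rw [adjMatrix_blowUp M₁_isSymm m M₁_eq_one_of_ne_zero (by decide +kernel),
    adjMatrix_blowUp M₂_isSymm m M₂_eq_one_of_ne_zero (by decide +kernel)]
  refine charpoly_eq_of_switch (S := switchDev.map Int.cast) ?_ ?_ ?_ ?_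
  · exact transpose_incMat_mul_incMat_mul m (fun q => by simp [switchDev])
      (fun q => by simp [switchDev])
  · rw [← Matrix.transpose_map, switchDev_transpose]
  · rw [← hmul]
    ext i j
    have h := congrFun (congrFun switchDev_sq i) j
    rw [Matrix.add_apply, Matrix.smul_apply, smul_eq_mul, Matrix.zero_apply] at h
    simpa using congrArg (Int.cast : ℤ → ℝ) h
  · have h2 : (2 : ℝ) • 1 + switchDev.map Int.cast =
        ((2 : ℤ) • 1 + switchDev).map (Int.cast : ℤ → ℝ) := by
      ext i j
      rw [Matrix.add_apply, Matrix.smul_apply, Matrix.map_apply, Matrix.map_apply,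
        Matrix.add_apply, Matrix.smul_apply, Matrix.one_apply, Matrix.one_apply]
      split_ifs <;> simp
    rw [h2, ← hmul, ← hmul, switch_conj]
    ext i j
    rw [Matrix.map_apply, Matrix.smul_apply, Matrix.smul_apply, Matrix.map_apply]
    simp

end Cospectral

section ForcingNumbers

lemma zfNum_blowUp_M₁_le (m : ℕ) : zfNum (blowUp M₁ M₁_isSymm m) ≤ 2 * m + 4 := by
  let x : Fin 6 → Fin 10 := ![0, 4, 1, 8, 7, 3]
  let y : Fin 6 → Fin 10 := ![7, 9, 8, 3, 6, 2]
  let x' : Fin 6 → Fin 10 ⊕ Fin 2 × Fin m := fun i => .inl (x i)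
  let y' : Fin 6 → Fin 10 ⊕ Fin 2 × Fin m := fun i => .inl (y i)
  have hy : Function.Injective y' := Sum.inl_injective.comp (by decide : Function.Injective y)
  have hadj : ∀ i, x i ≠ y i ∧ M₁ (x i) (y i) = 1 := by decide +kernel
  have hlt : ∀ i j, i < j → M₁ (x i) (y j) ≠ 1 ∧ x i ≠ y j := by decide +kernel
  have hS : IsZeroForcingSet (blowUp M₁ M₁_isSymm m) ↑(Finset.univ.image y')ᶜ := by
    rw [Finset.coe_compl, Finset.coe_image, Finset.coe_univ, Set.image_univ]
    exact isZeroForcingSet_compl_range x' y'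
      (fun i => blowUp_adj.mpr ⟨Sum.inl_injective.ne (hadj i).1, (hadj i).2⟩)
      fun i j hij => ⟨fun h => (hlt i j hij).1 (blowUp_adj.mp h).2,
        Sum.inl_injective.ne (hlt i j hij).2⟩
  refine (zfNum_le hS).trans ?_
  rw [Finset.card_compl, Finset.card_image_of_injective _ hy]
  simp
  omega

/-- Sets of classes that give rise to forts of the blow-ups of `M₂`, whatever the sizes of the
classes `5` and `8`. -/
def classForts : List (Finset (Fin 10)) :=
  [{1, 6}, {3, 4}, {0, 7, 8}, {2, 8, 9}, {0, 2, 7, 9}, {0, 3, 5, 7}, {0, 4, 5, 7}, {1, 2, 5, 9},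
    {2, 5, 6, 9}, {0, 1, 2, 5, 8}, {0, 2, 5, 6, 8}, {1, 3, 5, 7, 8}, {1, 4, 5, 7, 8},
    {3, 5, 6, 7, 8}, {4, 5, 6, 7, 8}, {0, 1, 3, 5, 8}, {0, 1, 4, 5, 8}, {0, 3, 5, 6, 8},
    {0, 4, 5, 6, 8}]

lemma classForts_nonempty : ∀ F ∈ classForts, F.Nonempty := by decide +kernel

lemma classForts_spec : ∀ F ∈ classForts, ∀ p, (p ∈ F → p ≠ 5 → p = 8) → ∀ q ∈ F, M₂ p q = 1 →
    ∃ q' ∈ F, q' ≠ q ∧ M₂ p q' = 1 :=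
  (by decide +kernel : ∀ F ∈ classForts, ∀ p, (p ∈ F → p ≠ 5 → p = 8) → ∀ q ∈ F,
    Matrix.of.symm M₂ p q = 1 → ∃ q' ∈ F, q' ≠ q ∧ Matrix.of.symm M₂ p q' = 1)

lemma exists_classFort_subset : ∀ T : Finset (Fin 10), 6 ≤ T.card → ∃ F ∈ classForts, F ⊆ T := by
  decide +kernel

lemma eq_of_cls_eq {m : ℕ} {u v : Fin 10 ⊕ Fin 2 × Fin m} (h : cls u = cls v) (h5 : cls u ≠ 5)
    (h8 : cls u ≠ 8) : u = v := by
  have key : ∀ (w : Fin 10 ⊕ Fin 2 × Fin m), cls w ≠ 5 → cls w ≠ 8 → w = .inl (cls w) := by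
    rintro (q | ⟨i, j⟩) h5 h8
    · rfl
    · fin_cases i
      · exact absurd rfl h5
      · exact absurd rfl h8
  rw [key u h5 h8, key v (h ▸ h5) (h ▸ h8), h]

lemma isFort_pair_of_cls_eq {M : Matrix (Fin 10) (Fin 10) ℤ} {hM : M.IsSymm} {m : ℕ}
    {a b : Fin 10 ⊕ Fin 2 × Fin m} (hab : a ≠ b) (h : cls a = cls b) :
    IsFort (blowUp M hM m) {a, b} := by
  refine ⟨⟨a, by simp⟩, fun u hu v hv huv => ?_⟩
  simp only [Set.mem_insert_iff, Set.mem_singleton_iff, not_or] at hu hv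
  rcases hv with rfl | rfl
  · exact ⟨b, by simp, hab.symm, hu.2, h ▸ huv.2⟩
  · exact ⟨a, by simp, hab, hu.1, h ▸ huv.2⟩

lemma isFort_preimage {m : ℕ} {T : Set (Fin 10 ⊕ Fin 2 × Fin m)} {F : Finset (Fin 10)}
    (hF : F ∈ classForts) (hFT : ↑F ⊆ cls '' T) :
    IsFort (blowUp M₂ M₂_isSymm m) (T ∩ cls ⁻¹' ↑F) := by
  constructor
  · obtain ⟨q, hq⟩ := classForts_nonempty F hF
    obtain ⟨t, ht, rfl⟩ := hFT hq
    exact ⟨t, ht, hq⟩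
  · rintro u hu v ⟨-, hv⟩ huv
    have hp : cls u ∈ F → cls u ≠ 5 → cls u = 8 := by
      intro huF h5
      by_contra h8
      obtain ⟨t, ht, htu⟩ := hFT huF
      exact hu ⟨eq_of_cls_eq htu.symm h5 h8 ▸ ht, huF⟩
    obtain ⟨q, hq, hne, hadj⟩ := classForts_spec F hF (cls u) hp (cls v) hv huv.2
    obtain ⟨t, ht, rfl⟩ := hFT hq
    refine ⟨t, ⟨ht, hq⟩, fun h => hne (h ▸ rfl), fun h => hu ?_, hadj⟩
    exact h ▸ ⟨ht, hq⟩

lemma lt_zfNum_blowUp_M₂ (m : ℕ) : 2 * m + 4 < zfNum (blowUp M₂ M₂_isSymm m) := by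
  obtain ⟨S, hS, hcard⟩ := exists_card_eq_zfNum (blowUp M₂ M₂_isSymm m)
  rw [← hcard]
  have hinj : Set.InjOn cls (↑Sᶜ : Set (Fin 10 ⊕ Fin 2 × Fin m)) := by
    intro a ha b hb h
    by_contra hab
    obtain ⟨v, hv, hvS⟩ := (isFort_pair_of_cls_eq hab h).inter_nonempty hS
    rcases hv with rfl | rfl
    · exact Finset.mem_compl.mp ha hvS
    · exact Finset.mem_compl.mp hb hvS
  have himg : (Sᶜ.image cls).card < 6 := by
    by_contra! hge
    obtain ⟨F, hF, hFT⟩ := exists_classFort_subset _ hge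
    have hFT' : (↑F : Set (Fin 10)) ⊆ cls '' (↑Sᶜ : Set (Fin 10 ⊕ Fin 2 × Fin m)) := by
      rw [← Finset.coe_image]
      exact_mod_cast hFT
    obtain ⟨v, ⟨hvT, -⟩, hvS⟩ := (isFort_preimage hF hFT').inter_nonempty hS
    exact Finset.mem_compl.mp hvT hvS
  rw [Finset.card_image_of_injOn hinj, Finset.card_compl] at himg
  simp at himg
  omega

end ForcingNumbers

end ZeroForcing

/-- For every `k ≥ 2` there exists a pair of non-isomorphic `2k`-regular
adjacency-cospectral graphs with different zero forcing numbers. -/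
theorem exists_regular_cospectral_different_zfNum (k : ℕ) (hk : 2 ≤ k) :
    ∃ (n : ℕ) (G G' : SimpleGraph (Fin n)),
      G.IsRegularOfDegree (2 * k) ∧ G'.IsRegularOfDegree (2 * k) ∧
      (G.adjMatrix ℝ).charpoly = (G'.adjMatrix ℝ).charpoly ∧
      ¬ Nonempty (G ≃g G') ∧
      zfNum G ≠ zfNum G' := by
  obtain ⟨m, hm⟩ : ∃ m, 2 * k = m + 4 := ⟨2 * k - 4, by omega⟩
  let G₁ := ZeroForcing.blowUp ZeroForcing.M₁ ZeroForcing.M₁_isSymm m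
  let G₂ := ZeroForcing.blowUp ZeroForcing.M₂ ZeroForcing.M₂_isSymm m
  let e₁ := G₁.overFinIso rfl
  let e₂ := G₂.overFinIso rfl
  have hne : zfNum (G₁.overFin rfl) ≠ zfNum (G₂.overFin rfl) := by
    rw [← ZeroForcing.zfNum_eq_of_iso e₁, ← ZeroForcing.zfNum_eq_of_iso e₂]
    exact ((ZeroForcing.zfNum_blowUp_M₁_le m).trans_lt (ZeroForcing.lt_zfNum_blowUp_M₂ m)).ne
  refine ⟨_, G₁.overFin rfl, G₂.overFin rfl, ?_, ?_, ?_,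
    fun ⟨e⟩ => hne (ZeroForcing.zfNum_eq_of_iso e), hne⟩
  · rw [hm]
    exact ZeroForcing.isRegularOfDegree_of_iso e₁ (ZeroForcing.isRegularOfDegree_blowUp _ m
      ZeroForcing.M₁_eq_one_of_ne_zero (by decide +kernel) (by decide +kernel) (by decide +kernel))
  · rw [hm]
    exact ZeroForcing.isRegularOfDegree_of_iso e₂ (ZeroForcing.isRegularOfDegree_blowUp _ m
      ZeroForcing.M₂_eq_one_of_ne_zero (by decide +kernel) (by decide +kernel) (by decide +kernel))
  · exact (ZeroForcing.charpoly_adjMatrix_eq_of_iso e₁).symm.trans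
      ((ZeroForcing.charpoly_blowUp_eq m).trans (ZeroForcing.charpoly_adjMatrix_eq_of_iso e₂))
end
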